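/- arXiv:1211.4647 — 5 statements merged into one kernel-verified Lean document; each statement's English description precedes it below -/
import Mathlib

section
/- Every subtree clutter of a forest satisfies the König property: the maximum number of pairwise vertex-disjoint edges equals the minimum cardinality of a vertex cover. -/
/-- A subtree clutter of a forest `F`. -/
def IsSubtreeClutter {V : Type*} (F : SimpleGraph V) (C : Set (Set V)) : Prop :=
  (∀ s ∈ C, (F.induce s).Connected) ∧ ∀ s ∈ C, ∀ t ∈ C, s ⊆ t → s = t

/-- An independent set of edges of a clutter: pairwise vertex-disjoint members. -/
def IsIndepEdgeSet {V : Type*} (C E : Set (Set V)) : Prop :=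
  E ⊆ C ∧ E.Pairwise Disjoint

/-- A vertex cover of a clutter: a set of vertices meeting every edge. -/
def IsVertexCover {V : Type*} (C : Set (Set V)) (W : Set V) : Prop :=
  ∀ s ∈ C, (s ∩ W).Nonempty

theorem stc_parent {V : Type*} (F : SimpleGraph V) (hF : F.IsAcyclic) :
    ∃ (d : V → ℕ) (par : V → V), ∀ u v, F.Adj u v →
      (par u = v ∧ d u = d v + 1) ∨ (par v = u ∧ d v = d u + 1) := by
  classical
  let root : V → V := fun v => (F.connectedComponentMk v).out
  have hr : ∀ v, F.Reachable v (root v) := fun v =>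
    (SimpleGraph.ConnectedComponent.exact (Quot.out_eq (F.connectedComponentMk v))).symm
  have hp : ∀ v, ∃ p : F.Walk v (root v), p.IsPath := fun v => (hr v).exists_isPath
  choose p hp using hp
  have hu : ∀ v w (q : F.Walk v w), q.IsPath → w = root v →
      q.length = (p v).length ∧ q.snd = (p v).snd := by
    intro v w q hq hw
    subst hw
    have := hF.path_unique ⟨q, hq⟩ ⟨p v, hp v⟩
    have : q = p v := congrArg Subtype.val this
    subst this
    exact ⟨rfl, rfl⟩
  have hroot : ∀ u v, F.Adj u v → root u = root v := by
    intro u v h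
    have : F.connectedComponentMk u = F.connectedComponentMk v :=
      SimpleGraph.ConnectedComponent.sound h.reachable
    simp only [root, this]
  have key : ∀ u v, F.Adj u v → v ∉ (p u).support →
      (p v).snd = u ∧ (p v).length = (p u).length + 1 := by
    intro u v h hv
    have := hu v _ (SimpleGraph.Walk.cons h.symm (p u)) ((hp u).cons hv) (hroot u v h)
    simp at this
    exact ⟨this.2.symm, this.1.symm⟩
  have lt : ∀ u v, F.Adj u v → v ∈ (p u).support → (p v).length < (p u).length := by
    intro u v h hv
    have h1 := (hu v _ ((p u).dropUntil v hv) ((hp u).dropUntil hv) (hroot u v h)).1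
    have h2 := congrArg SimpleGraph.Walk.length ((p u).take_spec hv)
    rw [SimpleGraph.Walk.length_append] at h2
    have h3 : ((p u).takeUntil v hv).length ≠ 0 := fun h0 =>
      h.ne (SimpleGraph.Walk.eq_of_length_eq_zero h0)
    omega
  refine ⟨fun v => (p v).length, fun v => (p v).snd, fun u v h => ?_⟩
  by_cases hv : v ∈ (p u).support
  · by_cases hu' : u ∈ (p v).support
    · have := lt u v h hv
      have := lt v u h.symm hu'
      omega
    · exact Or.inl (key v u h.symm hu')
  · exact Or.inr (key u v h hv)

theorem stc_climb {V : Type*} (F : SimpleGraph V) (d : V → ℕ) (par : V → V)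
    (hd : ∀ u v, F.Adj u v →
      (par u = v ∧ d u = d v + 1) ∨ (par v = u ∧ d v = d u + 1))
    (s : Set V) (hs : (F.induce s).Connected) (r : V) (hr : r ∈ s)
    (hmin : ∀ y ∈ s, d r ≤ d y) (x : V) (hx : x ∈ s) :
    ∃ k, par^[k] x = r ∧ d x = d r + k ∧ ∀ i ≤ k, par^[i] x ∈ s := by
  obtain ⟨w⟩ := hs.preconnected ⟨x, hx⟩ ⟨r, hr⟩
  suffices H : ∀ (a b : s) (w : (F.induce s).Walk a b), (b : V) = r →
      ∃ k, par^[k] a = r ∧ d a = d r + k ∧ ∀ i ≤ k, par^[i] (a : V) ∈ s from H _ _ w rfl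
  intro a b w
  induction w with
  | nil =>
    rename_i a
    intro h
    exact ⟨0, by simpa using h, by simp [h], fun i hi => by
      obtain rfl : i = 0 := by omega
      exact a.2⟩
  | cons h w ih =>
    rename_i a b c
    intro hc
    obtain ⟨k, h1, h2, h3⟩ := ih hc
    have hadj : F.Adj a b := h
    rcases hd _ _ hadj with ⟨e1, e2⟩ | ⟨e1, e2⟩
    · refine ⟨k + 1, by rw [Function.iterate_succ_apply, e1, h1], by omega, ?_⟩
      intro i hi
      cases i with
      | zero => exact a.2
      | succ i =>
        rw [Function.iterate_succ_apply, e1]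
        exact h3 i (by omega)
    · cases k with
      | zero =>
        have := hmin a a.2
        omega
      | succ k =>
        rw [Function.iterate_succ_apply, e1] at h1
        refine ⟨k, h1, by omega, fun i hi => ?_⟩
        have := h3 (i + 1) (by omega)
        rwa [Function.iterate_succ_apply, e1] at this

theorem stc_weak {V : Type*} [Fintype V] (C E : Set (Set V)) (W : Set V)
    (hE : IsIndepEdgeSet C E) (hW : IsVertexCover C W) : E.ncard ≤ W.ncard := by
  have hc : ∀ s : E, ∃ v : W, (v : V) ∈ (s : Set V) := fun s => by
    obtain ⟨v, h1, h2⟩ := hW s (hE.1 s.2)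
    exact ⟨⟨v, h2⟩, h1⟩
  choose f hf using hc
  rw [← Nat.card_coe_set_eq, ← Nat.card_coe_set_eq]
  refine Nat.card_le_card_of_injective f fun s t hst => ?_
  by_contra hne
  have := hE.2 s.2 t.2 (fun h => hne (Subtype.ext h))
  exact Set.disjoint_left.mp this (hf s) (hst ▸ hf t)

theorem stc_main {V : Type*} [Fintype V] (F : SimpleGraph V) (d : V → ℕ) (par : V → V)
    (hd : ∀ u v, F.Adj u v →
      (par u = v ∧ d u = d v + 1) ∨ (par v = u ∧ d v = d u + 1)) :
    ∀ (n : ℕ) (C : Set (Set V)), C.ncard ≤ n → (∀ s ∈ C, (F.induce s).Connected) →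
      ∃ E W, IsIndepEdgeSet C E ∧ IsVertexCover C W ∧ W.ncard ≤ E.ncard := by
  intro n
  induction n with
  | zero =>
    intro C hn hC
    have : C = ∅ := by
      rw [← Set.ncard_eq_zero (Set.toFinite _)]
      omega
    subst this
    exact ⟨∅, ∅, ⟨subset_rfl, by simp⟩, by simp [IsVertexCover], by simp⟩
  | succ n ih =>
    intro C hn hC
    rcases C.eq_empty_or_nonempty with rfl | hne
    · exact ⟨∅, ∅, ⟨subset_rfl, by simp⟩, by simp [IsVertexCover], by simp⟩
    have htop : ∀ s : C, ∃ r ∈ (s : Set V), ∀ y ∈ (s : Set V), d r ≤ d y := fun s =>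
      Set.exists_min_image _ d (Set.toFinite _)
        (Set.nonempty_coe_sort.mp (hC s s.2).nonempty)
    choose top h1 h2 using htop
    haveI : Nonempty C := hne.to_subtype
    obtain ⟨s, hs⟩ := Finite.exists_max (fun s : C => d (top s))
    have key : ∀ t ∈ C, top s ∉ t → Disjoint (s : Set V) t := by
      intro t ht hnt
      rw [Set.disjoint_left]
      intro x hxs hxt
      apply hnt
      obtain ⟨k, a1, a2, a3⟩ := stc_climb F d par hd s (hC s s.2) _ (h1 s) (h2 s) x hxs
      obtain ⟨j, b1, b2, b3⟩ :=
        stc_climb F d par hd t (hC t ht) _ (h1 ⟨t, ht⟩) (h2 ⟨t, ht⟩) x hxt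
      have := hs ⟨t, ht⟩
      rw [← a1]
      exact b3 k (by omega)
    have hlt : {t ∈ C | top s ∉ t}.ncard < C.ncard :=
      Set.ncard_lt_ncard ⟨fun t h => h.1, fun h => (h s.2).2 (h1 s)⟩ (Set.toFinite _)
    obtain ⟨E, W, hE, hW, hEW⟩ := ih {t ∈ C | top s ∉ t} (by omega) (fun t h => hC t h.1)
    refine ⟨insert (s : Set V) E, insert (top s) W, ⟨?_, ?_⟩, ?_, ?_⟩
    · rintro t (rfl | h)
      · exact s.2
      · exact (hE.1 h).1
    · refine hE.2.insert fun t ht _ => ?_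
      have := key t (hE.1 ht).1 (hE.1 ht).2
      exact ⟨this, this.symm⟩
    · intro t ht
      by_cases h : top s ∈ t
      · exact ⟨top s, h, Set.mem_insert _ _⟩
      · obtain ⟨v, a, b⟩ := hW t ⟨ht, h⟩
        exact ⟨v, a, Set.mem_insert_of_mem _ b⟩
    · have hsE : (s : Set V) ∉ E := fun h => (hE.1 h).2 (h1 s)
      rw [Set.ncard_insert_of_notMem hsE (Set.toFinite _)]
      have := Set.ncard_insert_le (top s) W
      omega

/-- Every subtree clutter of a forest satisfies the König property: the maximum
number of pairwise vertex-disjoint edges equals the minimum cardinality of a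
vertex cover. -/
theorem subtree_clutter_konig {V : Type*} [Fintype V]
    (F : SimpleGraph V) (hF : F.IsAcyclic) (C : Set (Set V))
    (hC : IsSubtreeClutter F C) :
    ∃ (E : Set (Set V)) (W : Set V),
      IsIndepEdgeSet C E ∧ IsVertexCover C W ∧ E.ncard = W.ncard ∧
      (∀ E', IsIndepEdgeSet C E' → E'.ncard ≤ E.ncard) ∧
      (∀ W', IsVertexCover C W' → W.ncard ≤ W'.ncard) := by
  obtain ⟨d, par, hd⟩ := stc_parent F hF
  obtain ⟨E, W, hE, hW, h⟩ := stc_main F d par hd C.ncard C le_rfl hC.1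
  have hw := stc_weak C E W hE hW
  exact ⟨E, W, hE, hW, le_antisymm hw h,
    fun E' hE' => (stc_weak C E' W hE' hW).trans h,
    fun W' hW' => h.trans (stc_weak C E W' hE hW')⟩
end

section
/- Let Δ be a simplicial tree. Then there exists a spanning tree G of the 1-skeleton of Δ such that for every facet H of Δ, the induced subgraph of G on the vertices of H is connected; consequently the facet ideal I(Δ) is a subtree ideal of the tree G. -/
/-- `F` is a leaf of the collection of facets `Γ`: either `Γ = {F}`, or there
is another facet `G` with `F ∩ H ⊆ F ∩ G` for all facets `H ≠ F`. -/
def IsLeafOf {V : Type*} [DecidableEq V] (Γ : Set (Finset V)) (F : Finset V) :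
    Prop :=
  F ∈ Γ ∧ (Γ = {F} ∨ ∃ G ∈ Γ, G ≠ F ∧ ∀ H ∈ Γ, H ≠ F → F ∩ H ⊆ F ∩ G)

/-- The 1-skeleton of the simplicial complex with facet set `Facets`: vertices
`u ≠ v` are adjacent iff they lie in a common facet. -/
def oneSkeleton {V : Type*} (Facets : Set (Finset V)) : SimpleGraph V :=
  SimpleGraph.fromRel fun u v => ∃ F ∈ Facets, u ∈ F ∧ v ∈ F

/-- A simplicial tree, described by its set of facets: the facets are nonempty,
none contains another, the complex is connected, and every nonempty
subcollection of facets contains a leaf. -/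
def IsSimplicialTree {V : Type*} [DecidableEq V] (Facets : Set (Finset V)) :
    Prop :=
  (∀ F ∈ Facets, F.Nonempty) ∧
  (∀ F ∈ Facets, ∀ G ∈ Facets, F ⊆ G → F = G) ∧
  (oneSkeleton Facets).Connected ∧
  ∀ Γ ⊆ Facets, Γ.Nonempty → ∃ F, IsLeafOf Γ F

/-- `E` is a leaf of `Γ` with joint `G`. -/
def SubtreeAux.Lf {V : Type*} [DecidableEq V] (Γ : Finset (Finset V)) (E G : Finset V) : Prop :=
  E ∈ Γ ∧ G ∈ Γ ∧ G ≠ E ∧ ∀ H ∈ Γ, H ≠ E → E ∩ H ⊆ G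

/-- Every subcollection with at least two members has a leaf. -/
def SubtreeAux.BA {V : Type*} [DecidableEq V] (Γ : Finset (Finset V)) : Prop :=
  ∀ Γ' ⊆ Γ, 1 < Γ'.card → ∃ E G, SubtreeAux.Lf Γ' E G

namespace SubtreeAux

variable {V : Type*} [DecidableEq V]

lemma BA.mono {Γ Γ' : Finset (Finset V)} (h : BA Γ) (hs : Γ' ⊆ Γ) : BA Γ' :=
  fun _ h1 h2 => h _ (h1.trans hs) h2

lemma BA.trace {Γ : Finset (Finset V)} (h : BA Γ) (W : Finset V) :
    BA (Γ.image (fun F => F ∩ W)) := by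
  intro Γ' hs hc
  have : ∀ s : Finset V, ∃ t : Finset V, s ∈ Γ' → t ∈ Γ ∧ t ∩ W = s := by
    intro s
    by_cases hsΓ : s ∈ Γ'
    · obtain ⟨t, ht, hts⟩ := Finset.mem_image.1 (hs hsΓ)
      exact ⟨t, fun _ => ⟨ht, hts⟩⟩
    · exact ⟨∅, fun h => absurd h hsΓ⟩
  choose g hg using this
  have hinj : Set.InjOn g (Γ' : Set (Finset V)) := by
    intro a ha b hb hab
    rw [← (hg a ha).2, ← (hg b hb).2, hab]
  obtain ⟨E, G, hE, hG, hne, hl⟩ := h (Γ'.image g) (by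
    intro x hx
    obtain ⟨s, hs', rfl⟩ := Finset.mem_image.1 hx
    exact (hg s hs').1) (by rwa [Finset.card_image_of_injOn hinj])
  obtain ⟨s, hs', rfl⟩ := Finset.mem_image.1 hE
  obtain ⟨t, ht', rfl⟩ := Finset.mem_image.1 hG
  refine ⟨s, t, hs', ht', fun e => hne (by rw [e]), ?_⟩
  intro K hK hKs
  have h1 := hl (g K) (Finset.mem_image_of_mem g hK) (fun e => hKs (hinj hK hs' e))
  intro x hx
  rw [← (hg s hs').2, ← (hg K hK).2] at hx
  rw [← (hg t ht').2]
  simp only [Finset.mem_inter] at hx ⊢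
  exact ⟨h1 (Finset.mem_inter.2 ⟨hx.1.1, hx.2.1⟩), hx.1.2⟩

lemma two_leaves (n : ℕ) : ∀ (Γ : Finset (Finset V)), Γ.card = n → BA Γ → 1 < Γ.card →
    ∀ F ∈ Γ, ∃ E G, Lf Γ E G ∧ E ≠ F := by
  induction n using Nat.strong_induction_on with
  | _ n ih =>
  intro Γ hn hB hc F hF
  obtain ⟨E, G, hE, hG, hne, hl⟩ := hB Γ subset_rfl hc
  by_cases hEF : E = F
  swap
  · exact ⟨E, G, ⟨hE, hG, hne, hl⟩, hEF⟩
  subst hEF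
  have hcard := Finset.card_erase_of_mem hE
  have hGe : G ∈ Γ.erase E := Finset.mem_erase.2 ⟨hne, hG⟩
  by_cases h2 : 1 < (Γ.erase E).card
  · obtain ⟨E', G', ⟨hE', hG', hne', hl'⟩, hEG⟩ :=
      ih _ (by omega) (Γ.erase E) rfl (hB.mono (Finset.erase_subset _ _)) h2 G hGe
    rw [Finset.mem_erase] at hE' hG'
    refine ⟨E', G', ⟨hE'.2, hG'.2, hne', ?_⟩, hE'.1⟩
    intro H hH hHE'
    by_cases hHE : H = E
    · subst hHE
      intro x hx
      rw [Finset.mem_inter] at hx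
      have hxG : x ∈ G := hl E' hE'.2 hE'.1 (Finset.mem_inter.2 ⟨hx.2, hx.1⟩)
      exact hl' G hGe (Ne.symm hEG) (Finset.mem_inter.2 ⟨hx.1, hxG⟩)
    · exact hl' H (Finset.mem_erase.2 ⟨hHE, hH⟩) hHE'
  · refine ⟨G, E, ⟨hG, hE, hne.symm, ?_⟩, hne⟩
    intro H hH hHG
    by_cases hHE : H = E
    · subst hHE; exact Finset.inter_subset_right
    · exact absurd (Finset.card_le_one.1 (not_lt.1 h2) H (Finset.mem_erase.2 ⟨hHE, hH⟩) G hGe) hHG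

/-- `p` is a nest point: members containing `p` form a chain. -/
def Nest (Γ : Finset (Finset V)) (p : V) : Prop :=
  ∀ H ∈ Γ, ∀ K ∈ Γ, p ∈ H → p ∈ K → H ⊆ K ∨ K ⊆ H

lemma exists_nest_outside (n : ℕ) : ∀ (W : Finset V) (Γ : Finset (Finset V)),
    W.card + Γ.card = n → BA Γ → (∀ H ∈ Γ, H ⊆ W) → ∀ F ∈ Γ, F ≠ W →
    ∃ p ∈ W, p ∉ F ∧ Nest Γ p := by
  induction n using Nat.strong_induction_on with
  | _ n ih =>
  intro W Γ hn hB hW F hF hFW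
  by_cases hWΓ : W ∈ Γ
  · have hcard := Finset.card_erase_of_mem hWΓ
    have hpos := Finset.card_pos.2 ⟨W, hWΓ⟩
    obtain ⟨p, hp, hpF, hN⟩ := ih (W.card + (Γ.erase W).card) (by omega) W (Γ.erase W) rfl
      (hB.mono (Finset.erase_subset _ _)) (fun H hH => hW H (Finset.mem_of_mem_erase hH))
      F (Finset.mem_erase.2 ⟨hFW, hF⟩) hFW
    refine ⟨p, hp, hpF, ?_⟩
    intro H hH K hK hpH hpK
    by_cases h1 : H = W
    · right; rw [h1]; exact hW K hK
    by_cases h2 : K = W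
    · left; rw [h2]; exact hW H hH
    exact hN H (Finset.mem_erase.2 ⟨h1, hH⟩) K (Finset.mem_erase.2 ⟨h2, hK⟩) hpH hpK
  classical
  let M := Γ.filter (fun H => ∀ K ∈ Γ, H ⊆ K → K ⊆ H)
  have hMle : ∀ H ∈ Γ, ∃ K ∈ M, H ⊆ K := by
    intro H hH
    obtain ⟨K, hHK, hK⟩ := Γ.exists_le_maximal hH
    exact ⟨K, Finset.mem_filter.2 ⟨hK.1, fun L hL hKL => hK.2 hL hKL⟩, hHK⟩
  have hMΓ : M ⊆ Γ := Finset.filter_subset _ _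
  obtain ⟨F', hF', hFF'⟩ := hMle F hF
  by_cases hM : 1 < M.card
  · obtain ⟨E, G, ⟨hE, hG, hne, hl⟩, hEF⟩ := two_leaves _ M rfl (hB.mono hMΓ) hM F' hF'
    have hEΓ := hMΓ hE
    have hEW : E ⊂ W := (hW E hEΓ).ssubset_of_ne (fun e => hWΓ (e ▸ hEΓ))
    have hc1 := Finset.card_lt_card hEW
    have hc2 : (Γ.image (fun H => H ∩ E)).card ≤ Γ.card := Finset.card_image_le
    obtain ⟨p, hpE, hpG, hN⟩ := ih _ (by omega) E (Γ.image (fun H => H ∩ E)) rfl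
      (hB.trace E) (by
        intro H hH
        obtain ⟨K, -, rfl⟩ := Finset.mem_image.1 hH
        exact Finset.inter_subset_right) (G ∩ E) (Finset.mem_image.2 ⟨G, hMΓ hG, rfl⟩) (by
        intro e
        have h1 : E ⊆ G := Finset.inter_eq_right.1 e
        exact hne ((((Finset.mem_filter.1 hE).2 G (hMΓ hG) h1)).antisymm h1))
    have hpG' : p ∉ G := fun h => hpG (Finset.mem_inter.2 ⟨h, hpE⟩)
    have hsub : ∀ H ∈ Γ, p ∈ H → H ⊆ E := by
      intro H hH hpH
      obtain ⟨K, hK, hHK⟩ := hMle H hH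
      by_cases hKE : K = E
      · exact hKE ▸ hHK
      · exact absurd (hl K hK hKE (Finset.mem_inter.2 ⟨hpE, hHK hpH⟩)) hpG'
    refine ⟨p, hEW.1 hpE, ?_, ?_⟩
    · intro hpF
      exact hpG' (hl F' hF' hEF.symm (Finset.mem_inter.2 ⟨hpE, hFF' hpF⟩))
    · intro H hH K hK hpH hpK
      have h1 := hN (H ∩ E) (Finset.mem_image.2 ⟨H, hH, rfl⟩) (K ∩ E)
        (Finset.mem_image.2 ⟨K, hK, rfl⟩) (Finset.mem_inter.2 ⟨hpH, hpE⟩)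
        (Finset.mem_inter.2 ⟨hpK, hpE⟩)
      rwa [Finset.inter_eq_left.2 (hsub H hH hpH), Finset.inter_eq_left.2 (hsub K hK hpK)] at h1
  · have hF'W : F' ⊂ W :=
      (hW F' (hMΓ hF')).ssubset_of_ne (fun e => hWΓ (e ▸ hMΓ hF'))
    obtain ⟨p, hpW, hpF'⟩ := Finset.exists_of_ssubset hF'W
    refine ⟨p, hpW, fun h => hpF' (hFF' h), ?_⟩
    intro H hH K hK hpH hpK
    obtain ⟨L, hL, hHL⟩ := hMle H hH
    have := Finset.card_le_one.1 (not_lt.1 hM) L hL F' hF'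
    exact absurd (this ▸ hHL hpH) hpF'

lemma exists_nest (W : Finset V) (Γ : Finset (Finset V)) (hB : BA Γ) (hW : ∀ H ∈ Γ, H ⊆ W)
    (hne : W.Nonempty) : ∃ p ∈ W, Nest Γ p := by
  by_cases h : ∃ F ∈ Γ, F ≠ W
  · obtain ⟨F, hF, hFW⟩ := h
    obtain ⟨p, hp, -, hN⟩ := exists_nest_outside _ W Γ rfl hB hW F hF hFW
    exact ⟨p, hp, hN⟩
  · push Not at h
    obtain ⟨p, hp⟩ := hne
    refine ⟨p, hp, fun H hH K hK _ _ => ?_⟩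
    rw [h H hH, h K hK]
    exact Or.inl subset_rfl

/-- Connectedness of `T` inside `F`, in terms of chains. -/
def PC (T : SimpleGraph V) (F : Finset V) : Prop :=
  ∀ a ∈ F, ∀ b ∈ F, Relation.ReflTransGen (fun x y => x ∈ F ∧ y ∈ F ∧ T.Adj x y) a b

lemma chain_mono {α : Type*} {r s : α → α → Prop} (h : ∀ x y, r x y → s x y) {a b : α}
    (hab : Relation.ReflTransGen r a b) : Relation.ReflTransGen s a b := by
  induction hab with
  | refl => exact Relation.ReflTransGen.refl
  | tail _ h2 ih => exact ih.tail (h _ _ h2)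

lemma PC.mono {T T' : SimpleGraph V} {F : Finset V} (h : PC T F) (hT : T ≤ T') : PC T' F :=
  fun a ha b hb => chain_mono (fun _ _ h => ⟨h.1, h.2.1, hT h.2.2⟩)
    (h a ha b hb)

lemma PC.insert {T : SimpleGraph V} {F : Finset V} {p u : V} (h : PC T (F.erase p))
    (hp : p ∈ F) (hu : u ∈ F.erase p) (hadj : T.Adj p u) : PC T F := by
  have huF := Finset.mem_of_mem_erase hu
  have key : ∀ a ∈ F, ∀ b ∈ F, a ≠ p → b ≠ p →
      Relation.ReflTransGen (fun x y => x ∈ F ∧ y ∈ F ∧ T.Adj x y) a b := fun a ha b hb h1 h2 =>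
    chain_mono (fun x y h => ⟨Finset.mem_of_mem_erase h.1,
      Finset.mem_of_mem_erase h.2.1, h.2.2⟩)
      (h a (Finset.mem_erase.2 ⟨h1, ha⟩) b (Finset.mem_erase.2 ⟨h2, hb⟩))
  have hup := (Finset.mem_erase.1 hu).1
  intro a ha b hb
  by_cases h1 : a = p
  · by_cases h2 : b = p
    · rw [h1, h2]
    · subst h1
      exact Relation.ReflTransGen.head ⟨hp, huF, hadj⟩ (key u huF b hb hup h2)
  · by_cases h2 : b = p
    · subst h2
      exact Relation.ReflTransGen.tail (key a ha u huF h1 hup) ⟨huF, hp, hadj.symm⟩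
    · exact key a ha b hb h1 h2

lemma exists_forest (n : ℕ) : ∀ (W : Finset V) (Γ : Finset (Finset V)), W.card = n → BA Γ →
    (∀ H ∈ Γ, H ⊆ W) → ∃ T : SimpleGraph V, T.IsAcyclic ∧
      (∀ u v, T.Adj u v → ∃ F ∈ Γ, u ∈ F ∧ v ∈ F) ∧ ∀ F ∈ Γ, PC T F := by
  induction n with
  | zero =>
    intro W Γ hn hB hW
    refine ⟨⊥, SimpleGraph.isAcyclic_bot, fun u v h => h.elim, fun F hF a ha => ?_⟩
    have := hW F hF ha
    rw [Finset.card_eq_zero.1 hn] at this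
    simp at this
  | succ n ih =>
    intro W Γ hn hB hW
    obtain ⟨p, hpW, hN⟩ := exists_nest W Γ hB hW (Finset.card_pos.1 (by omega))
    have htr : ∀ F ∈ Γ, F ∩ W.erase p = F.erase p := by
      intro F hF
      ext x
      have := @hW F hF x
      simp only [Finset.mem_inter, Finset.mem_erase]
      tauto
    obtain ⟨T, hT, hadj, hPC⟩ := ih (W.erase p) (Γ.image (fun F => F ∩ W.erase p))
      (by rw [Finset.card_erase_of_mem hpW]; omega) (hB.trace _) (by
        intro H hH
        obtain ⟨K, -, rfl⟩ := Finset.mem_image.1 hH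
        exact Finset.inter_subset_right)
    have hadj' : ∀ u v, T.Adj u v → u ≠ p ∧ ∃ F ∈ Γ, u ∈ F ∧ v ∈ F := by
      intro u v huv
      obtain ⟨F, hF, hu, hv⟩ := hadj u v huv
      obtain ⟨K, hK, rfl⟩ := Finset.mem_image.1 hF
      simp only [Finset.mem_inter, Finset.mem_erase] at hu hv
      exact ⟨hu.2.1, K, hK, hu.1, hv.1⟩
    have hPC' : ∀ F ∈ Γ, PC T (F.erase p) := by
      intro F hF
      rw [← htr F hF]
      exact hPC _ (Finset.mem_image_of_mem _ hF)
    let Q := Γ.filter (fun F => p ∈ F ∧ (F.erase p).Nonempty)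
    by_cases hQ : Q.Nonempty
    · obtain ⟨F₁, hF₁, hmin⟩ := Q.exists_min_image Finset.card hQ
      obtain ⟨hF₁Γ, hpF₁, u, hu⟩ := Finset.mem_filter.1 hF₁
      have hup := (Finset.mem_erase.1 hu).1
      have hE : (T ⊔ SimpleGraph.edge p u).Adj p u :=
        Or.inr ((SimpleGraph.edge_adj ..).2 ⟨Or.inl ⟨rfl, rfl⟩, hup.symm⟩)
      refine ⟨T ⊔ SimpleGraph.edge p u, ?_, ?_, ?_⟩
      · refine hT.sup_edge_of_not_reachable ?_
        rintro ⟨w⟩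
        cases w with
        | nil => exact hup rfl
        | cons h _ => exact (hadj' _ _ h).1 rfl
      · rintro a b (hab | hab)
        · exact (hadj' a b hab).2
        · obtain ⟨(⟨rfl, rfl⟩ | ⟨rfl, rfl⟩), -⟩ := (SimpleGraph.edge_adj ..).1 hab
          · exact ⟨F₁, hF₁Γ, hpF₁, Finset.mem_of_mem_erase hu⟩
          · exact ⟨F₁, hF₁Γ, Finset.mem_of_mem_erase hu, hpF₁⟩
      · intro F hF
        have hm := (hPC' F hF).mono (le_sup_left : T ≤ T ⊔ SimpleGraph.edge p u)
        by_cases hpF : p ∈ F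
        swap
        · rwa [Finset.erase_eq_of_notMem hpF] at hm
        by_cases hne : (F.erase p).Nonempty
        · have hFF : F₁ ⊆ F := by
            rcases hN F₁ hF₁Γ F hF hpF₁ hpF with h | h
            · exact h
            · rw [Finset.eq_of_subset_of_card_le h
                (hmin F (Finset.mem_filter.2 ⟨hF, hpF, hne⟩))]
          exact hm.insert hpF (Finset.erase_subset_erase _ hFF hu) hE
        · intro a ha b hb
          have : ∀ x ∈ F, x = p := fun x hx => by
            by_contra hxp
            exact hne ⟨x, Finset.mem_erase.2 ⟨hxp, hx⟩⟩
          rw [this a ha, this b hb]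
    · refine ⟨T, hT, fun a b h => (hadj' a b h).2, fun F hF => ?_⟩
      by_cases hpF : p ∈ F
      · intro a ha b hb
        have : ∀ x ∈ F, x = p := fun x hx => by
          by_contra hxp
          exact hQ ⟨F, Finset.mem_filter.2 ⟨hF, hpF, x, Finset.mem_erase.2 ⟨hxp, hx⟩⟩⟩
        rw [this a ha, this b hb]
      · have := hPC' F hF
        rwa [Finset.erase_eq_of_notMem hpF] at this

lemma PC.reachable {T : SimpleGraph V} {F : Finset V} (h : PC T F) {a b : V} (ha : a ∈ F)
    (hb : b ∈ F) : T.Reachable a b := by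
  have := h a ha b hb
  induction this with
  | refl => rfl
  | tail h1 h2 ih => exact (ih h2.1).trans h2.2.2.reachable

lemma PC.preconnected {T : SimpleGraph V} {F : Finset V} (h : PC T F) :
    (T.induce (↑F : Set V)).Preconnected := by
  rintro ⟨a, ha⟩ ⟨b, hb⟩
  have := h a ha b hb
  induction this with
  | refl => rfl
  | @tail c d h1 h2 ih =>
    refine (ih h2.1).trans (SimpleGraph.Adj.reachable ?_)
    exact h2.2.2

end SubtreeAux

/-- Let `Δ` be a simplicial tree.  Then there is a spanning tree `G` of the
1-skeleton of `Δ` such that the induced subgraph of `G` on each facet is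
connected; consequently the facet ideal `I(Δ)` is a subtree ideal of the tree
`G`: its generators are the monomials of a family of subtrees of `G`. -/
theorem simplicialTree_is_subtree_ideal {V : Type*} [Fintype V] [DecidableEq V]
    (k : Type*) [Field k] (Facets : Set (Finset V))
    (hΔ : IsSimplicialTree Facets) :
    ∃ G : SimpleGraph V, G ≤ oneSkeleton Facets ∧ G.IsTree ∧
      (∀ F ∈ Facets, (G.induce (↑F : Set V)).Connected) ∧
      ∃ 𝒮 : Set (Finset V), (∀ s ∈ 𝒮, (G.induce (↑s : Set V)).Connected) ∧
        Ideal.span ((fun s : Finset V => ∏ v ∈ s, MvPolynomial.X v) '' Facets)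
          = Ideal.span
            ((fun s : Finset V => ∏ v ∈ s, (MvPolynomial.X v : MvPolynomial V k)) '' 𝒮) := by
  classical
  obtain ⟨hne, -, hconn, hleaf⟩ := hΔ
  have hB : SubtreeAux.BA Facets.toFinset := by
    intro Γ' hs hc
    obtain ⟨E, hE, h⟩ := hleaf (Γ' : Set (Finset V)) (fun x hx => Set.mem_toFinset.1 (hs hx))
      (Finset.coe_nonempty.2 (Finset.card_pos.1 (by omega)))
    rcases h with h | ⟨G, hG, hGE, h⟩
    · rw [Finset.coe_eq_singleton] at h
      rw [h] at hc
      simp at hc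
    · exact ⟨E, G, hE, hG, hGE, fun H hH hHE => (h H hH hHE).trans Finset.inter_subset_right⟩
  obtain ⟨T, hT, hadj, hPC⟩ := SubtreeAux.exists_forest _ Finset.univ Facets.toFinset rfl hB
    (fun H _ => Finset.subset_univ H)
  have hind : ∀ F ∈ Facets, (T.induce (↑F : Set V)).Connected := by
    intro F hF
    haveI : Nonempty (↑F : Set V) := (hne F hF).to_subtype
    exact ⟨(hPC F (Set.mem_toFinset.2 hF)).preconnected⟩
  refine ⟨T, ?_, ⟨?_, hT⟩, hind, Facets, hind, rfl⟩
  · intro a b hab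
    obtain ⟨F, hF, ha, hb⟩ := hadj a b hab
    exact (SimpleGraph.fromRel_adj ..).2 ⟨hab.ne, Or.inl ⟨F, Set.mem_toFinset.1 hF, ha, hb⟩⟩
  · haveI := hconn.nonempty
    refine ⟨fun a b => ?_⟩
    obtain ⟨w⟩ := hconn.preconnected a b
    induction w with
    | nil => rfl
    | cons h _ ih =>
      refine SimpleGraph.Reachable.trans ?_ ih
      obtain ⟨-, (⟨F, hF, h1, h2⟩ | ⟨F, hF, h1, h2⟩)⟩ := (SimpleGraph.fromRel_adj ..).1 h
      · exact (hPC F (Set.mem_toFinset.2 hF)).reachable h1 h2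
      · exact (hPC F (Set.mem_toFinset.2 hF)).reachable h2 h1
end

section
/- Let S_n be the path graph on n vertices, R = k[x_1,...,x_n], and P_ℓ(S_n) the ideal generated by all products x_i x_{i+1} ⋯ x_{i+ℓ} of ℓ+1 consecutive variables (1 ≤ i ≤ n - ℓ). Write n = (ℓ+1) + b(ℓ+2) + c with 0 ≤ c < ℓ+2. Then depth(R/P_ℓ(S_n)) = ℓ(b+1) if c = 0 and depth(R/P_ℓ(S_n)) = ℓ(b+1) + c - 1 if c > 0. -/
/-- The path ideal `P_ℓ(S_n)` of the path graph (spine) on `n` vertices: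
the ideal of `k[x_1,…,x_n]` generated by the products
`x_i x_{i+1} ⋯ x_{i+ℓ}` of `ℓ+1` consecutive variables (0-based indexing). -/
noncomputable def spinePathIdeal (k : Type*) [Field k] (n ℓ : ℕ) :
    Ideal (MvPolynomial (Fin n) k) :=
  Ideal.span (Set.image (fun i : ℕ => ∏ v ∈ Finset.univ.filter
      (fun v : Fin n => i ≤ (v : ℕ) ∧ (v : ℕ) ≤ i + ℓ), MvPolynomial.X v)
    {i : ℕ | i + ℓ < n})

/-- The depth of `R/I` with respect to the maximal homogeneous ideal of the
polynomial ring `R = k[x_1,…,x_n]`: the largest length of a regular sequence on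
`R/I` consisting of elements of the irrelevant maximal ideal. -/
noncomputable def quotientDepth (k : Type*) [Field k] {n : ℕ}
    (I : Ideal (MvPolynomial (Fin n) k)) : ℕ :=
  sSup {d | ∃ rs : List (MvPolynomial (Fin n) k), rs.length = d ∧
    (∀ r ∈ rs, r ∈ Ideal.span
      (Set.range (MvPolynomial.X : Fin n → MvPolynomial (Fin n) k))) ∧
    RingTheory.Sequence.IsRegular (MvPolynomial (Fin n) k ⧸ I) rs}

universe u

open CategoryTheory Abelian in
/-- Vanishing of `Ext^i(R/m, R/I)`. -/
def SpineVan {R : Type u} [CommRing R] (m I : Ideal R) (i : ℕ) : Prop :=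
  Subsingleton (Ext (ModuleCat.of R (R ⧸ m)) (ModuleCat.of R (R ⧸ I)) i)

/-- `d` is the least degree with `Ext^d(R/m, R/I) ≠ 0`. -/
def SpineHD {R : Type u} [CommRing R] (m I : Ideal R) (d : ℕ) : Prop :=
  (∀ i < d, SpineVan m I i) ∧ ¬ SpineVan m I d

open CategoryTheory Abelian in
theorem spine_ext_zero {R : Type u} [CommRing R] (m : Ideal R) (x : R) (hx : x ∈ m)
    {A B : ModuleCat.{u} R} (h : A ⟶ B) (i : ℕ) (e : Ext (ModuleCat.of R (R ⧸ m)) A i) :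
    e.comp (Ext.mk₀ (x • h)) (add_zero i) = 0 := by
  have h0 : x • 𝟙 (ModuleCat.of R (R ⧸ m)) = 0 := by
    apply ModuleCat.hom_ext
    refine LinearMap.ext fun y => ?_
    obtain ⟨y, rfl⟩ := Ideal.Quotient.mk_surjective (I := m) y
    change x • (Ideal.Quotient.mk m y) = 0
    rw [← Ideal.Quotient.mk_eq_mk, ← Submodule.Quotient.mk_smul, Ideal.Quotient.mk_eq_mk,
      Ideal.Quotient.eq_zero_iff_mem]
    exact m.mul_mem_right _ hx
  have h1 : x • e = 0 := by
    have : x • e = (Ext.mk₀ (x • 𝟙 (ModuleCat.of R (R ⧸ m)))).comp e (zero_add i) := by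
      simp [Ext.mk₀_smul]
    rw [this, h0]; simp
  rw [Ext.mk₀_smul, Ext.comp_smul, ← Ext.smul_comp, h1]
  simp

open CategoryTheory Abelian in
theorem spine_van {R : Type u} [CommRing R] (m I J : Ideal R) (x g : R) (hx : x ∈ m)
    (hreg : ∀ r, x * r ∈ I → r ∈ I) (hJ : ∀ r, r ∈ J ↔ x * g * r ∈ I) :
    SpineVan m J 0 ∧ ∀ i, SpineVan m (I ⊔ Ideal.span {x * g}) i ↔
      SpineVan m I i ∧ SpineVan m J (i + 1) := by
  set K := I ⊔ Ideal.span {x * g} with hK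
  have hle : J ≤ Submodule.comap (LinearMap.mulLeft R g) I := by
    intro r hr
    have := (hJ r).1 hr
    rw [mul_assoc] at this
    exact hreg _ this
  let h : (R ⧸ J) →ₗ[R] (R ⧸ I) := Submodule.mapQ J I (LinearMap.mulLeft R g) hle
  have hmk : ∀ r : R, h (Ideal.Quotient.mk J r) = Ideal.Quotient.mk I (g * r) := fun r => rfl
  let q : (R ⧸ I) →ₗ[R] (R ⧸ K) := Submodule.mapQ I K LinearMap.id (le_sup_left : I ≤ K)
  have qmk : ∀ r : R, q (Ideal.Quotient.mk I r) = Ideal.Quotient.mk K r := fun r => rfl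
  have fmk : ∀ r : R, (x • h) (Ideal.Quotient.mk J r) = Ideal.Quotient.mk I (x * g * r) := by
    intro r
    rw [LinearMap.smul_apply, hmk, mul_assoc]; rfl
  have hex : Function.Exact (x • h) q := by
    intro y
    obtain ⟨y, rfl⟩ := Ideal.Quotient.mk_surjective y
    rw [qmk, Ideal.Quotient.eq_zero_iff_mem]
    constructor
    · intro hy
      obtain ⟨a, ha, b, hb, rfl⟩ := Submodule.mem_sup.1 hy
      obtain ⟨c, rfl⟩ := Ideal.mem_span_singleton'.1 hb
      refine ⟨Ideal.Quotient.mk J c, ?_⟩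
      rw [fmk, Ideal.Quotient.eq]
      have : x * g * c - (a + c * (x * g)) = - a := by ring
      rw [this]; exact I.neg_mem ha
    · rintro ⟨z, hz⟩
      obtain ⟨z, rfl⟩ := Ideal.Quotient.mk_surjective z
      rw [fmk, Ideal.Quotient.eq] at hz
      have h1 : y = - (x * g * z - y) + z * (x * g) := by ring
      rw [h1]
      exact Submodule.add_mem_sup (I.neg_mem hz) (Ideal.mem_span_singleton'.2 ⟨z, rfl⟩)
  let S : ShortComplex (ModuleCat.{u} R) :=
    ModuleCat.shortComplexOfCompEqZero (x • h) q hex.linearMap_comp_eq_zero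
  have hS : S.ShortExact :=
    { exact := ModuleCat.shortComplex_exact _ hex
      mono_f := by
        rw [ModuleCat.mono_iff_injective]
        change Function.Injective (x • h)
        rw [injective_iff_map_eq_zero]
        intro z hz
        obtain ⟨z, rfl⟩ := Ideal.Quotient.mk_surjective z
        rw [fmk, Ideal.Quotient.eq_zero_iff_mem] at hz
        rw [Ideal.Quotient.eq_zero_iff_mem]
        exact (hJ z).2 hz
      epi_g := by
        rw [ModuleCat.epi_iff_surjective]
        change Function.Surjective q
        intro z
        obtain ⟨z, rfl⟩ := Ideal.Quotient.mk_surjective z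
        exact ⟨Ideal.Quotient.mk I z, rfl⟩ }
  have hSf : S.f = x • ModuleCat.ofHom h := rfl
  have hz : ∀ i (e : Ext (ModuleCat.of R (R ⧸ m)) S.X₁ i),
      e.comp (Ext.mk₀ S.f) (add_zero i) = 0 := by
    intro i e
    rw [hSf]
    exact spine_ext_zero m x hx _ i e
  have e1 : ∀ i, SpineVan m J i = Subsingleton (Ext (ModuleCat.of R (R ⧸ m)) S.X₁ i) :=
    fun i => rfl
  have e2 : ∀ i, SpineVan m I i = Subsingleton (Ext (ModuleCat.of R (R ⧸ m)) S.X₂ i) :=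
    fun i => rfl
  have e3 : ∀ i, SpineVan m K i = Subsingleton (Ext (ModuleCat.of R (R ⧸ m)) S.X₃ i) :=
    fun i => rfl
  have := hS.mono_f
  refine ⟨?_, fun i => ?_⟩
  · rw [e1]
    refine subsingleton_of_forall_eq 0 fun e => ?_
    apply Ext.postcomp_mk₀_injective_of_mono (ModuleCat.of R (R ⧸ m)) S.f
    simpa using hz 0 e
  · rw [e1, e2, e3]
    constructor
    · intro hs
      constructor
      · refine subsingleton_of_forall_eq 0 fun e => ?_
        obtain ⟨y, rfl⟩ := Ext.covariant_sequence_exact₂ _ hS e (Subsingleton.elim _ _)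
        exact hz _ _
      · refine subsingleton_of_forall_eq 0 fun e => ?_
        obtain ⟨y, rfl⟩ := Ext.covariant_sequence_exact₁ _ hS e (hz _ _) rfl
        rw [Subsingleton.elim y 0]; simp
    · rintro ⟨h2, h1⟩
      refine subsingleton_of_forall_eq 0 fun e => ?_
      obtain ⟨y, rfl⟩ := Ext.covariant_sequence_exact₃ _ hS e rfl (Subsingleton.elim _ _)
      rw [Subsingleton.elim y 0]; simp

theorem spine_step {R : Type u} [CommRing R] (m I J : Ideal R) (x g : R) (hx : x ∈ m)
    (hreg : ∀ r, x * r ∈ I → r ∈ I) (hJ : ∀ r, r ∈ J ↔ x * g * r ∈ I) {d₁ d₂ : ℕ}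
    (h1 : SpineHD m I d₁) (h2 : SpineHD m J (d₂ + 1)) :
    SpineHD m (I ⊔ Ideal.span {x * g}) (min d₁ d₂) := by
  obtain ⟨-, hv⟩ := spine_van m I J x g hx hreg hJ
  refine ⟨fun i hi => (hv i).2 ⟨h1.1 i (by omega), h2.1 _ (by omega)⟩, fun hc => ?_⟩
  have := (hv _).1 hc
  rcases le_total d₁ d₂ with h | h
  · rw [min_eq_left h] at this; exact h1.2 this.1
  · rw [min_eq_right h] at this; exact h2.2 this.2

theorem spine_step_back {R : Type u} [CommRing R] (m I : Ideal R) (x : R) (hx : x ∈ m)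
    (hreg : ∀ r, x * r ∈ I → r ∈ I) {d : ℕ}
    (h1 : SpineHD m (I ⊔ Ideal.span {x}) d) : SpineHD m I (d + 1) := by
  obtain ⟨h0, hv⟩ := spine_van m I I x 1 hx hreg
    (fun r => ⟨fun h => I.mul_mem_left _ h, fun h => hreg _ (by simpa using h)⟩)
  rw [mul_one] at hv
  have key : ∀ i < d + 1, SpineVan m I i := by
    intro i hi
    cases i with
    | zero => exact h0
    | succ i => exact ((hv i).1 (h1.1 i (by omega))).2
  exact ⟨key, fun hc => h1.2 ((hv d).2 ⟨key d (by omega), hc⟩)⟩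

theorem spine_hd_self {R : Type u} [CommRing R] (m : Ideal R) (hm : m ≠ ⊤) : SpineHD m m 0 := by
  refine ⟨fun i hi => by omega, fun hc => ?_⟩
  have h1 : Subsingleton (ModuleCat.of R (R ⧸ m) ⟶ ModuleCat.of R (R ⧸ m)) :=
    CategoryTheory.Abelian.Ext.addEquiv₀.subsingleton_congr.mp hc
  have h2 : Subsingleton ((R ⧸ m) →ₗ[R] (R ⧸ m)) :=
    (ModuleCat.homAddEquiv (M := ModuleCat.of R (R ⧸ m))
      (N := ModuleCat.of R (R ⧸ m))).symm.subsingleton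
  have h3 := LinearMap.congr_fun (Subsingleton.elim (LinearMap.id : (R ⧸ m) →ₗ[R] (R ⧸ m)) 0)
    (Ideal.Quotient.mk m 1)
  simp only [LinearMap.id_apply, LinearMap.zero_apply] at h3
  exact hm ((Ideal.eq_top_iff_one m).2 (Ideal.Quotient.eq_zero_iff_mem.1 h3))

theorem spine_rees {R : Type u} [CommRing R] [IsNoetherianRing R] (m I : Ideal R) (hm : m ≠ ⊤)
    (hI : I ≤ m) {d : ℕ} (hd : SpineHD m I d) :
    sSup {d | ∃ rs : List R, rs.length = d ∧ (∀ r ∈ rs, r ∈ m) ∧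
      RingTheory.Sequence.IsRegular (R ⧸ I) rs} = d := by
  have hlt : m • (⊤ : Submodule R (ModuleCat.of R (R ⧸ I))) < ⊤ := by
    rw [lt_top_iff_ne_top]
    intro h
    let q : (R ⧸ I) →ₗ[R] (R ⧸ m) := Submodule.mapQ I m LinearMap.id hI
    have h1 : (Ideal.Quotient.mk I 1) ∈ m • (⊤ : Submodule R (R ⧸ I)) := by
      have : m • (⊤ : Submodule R (R ⧸ I)) = ⊤ := h
      rw [this]; trivial
    have h2 : m • (⊤ : Submodule R (R ⧸ I)) ≤ LinearMap.ker q := by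
      rw [Submodule.smul_le]
      intro r hr y _
      obtain ⟨y, rfl⟩ := Ideal.Quotient.mk_surjective y
      rw [LinearMap.mem_ker, map_smul]
      change Ideal.Quotient.mk m (r * y) = 0
      exact Ideal.Quotient.eq_zero_iff_mem.2 (m.mul_mem_right _ hr)
    have h3 : Ideal.Quotient.mk m 1 = 0 := h2 h1
    exact hm ((Ideal.eq_top_iff_one m).2 (Ideal.Quotient.eq_zero_iff_mem.1 h3))
  have hsupp : Module.support R (ModuleCat.of R (R ⧸ m)) = PrimeSpectrum.zeroLocus m := by
    change Module.support R (R ⧸ m) = _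
    rw [Module.support_eq_zeroLocus, Ideal.annihilator_quotient]
  have hf1 : Module.Finite R (ModuleCat.of R (R ⧸ m)) :=
    inferInstanceAs (Module.Finite R (R ⧸ m))
  have hf2 : Module.Finite R (ModuleCat.of R (R ⧸ I)) :=
    inferInstanceAs (Module.Finite R (R ⧸ I))
  refine IsGreatest.csSup_eq ⟨?_, ?_⟩
  · exact ModuleCat.exists_isRegular_of_exists_subsingleton_ext m d (ModuleCat.of R (R ⧸ I)) hlt
      (ModuleCat.of R (R ⧸ m)) hsupp hd.1
  · rintro e ⟨rs, hl, hmem, hreg⟩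
    by_contra hlt'
    exact hd.2 (ModuleCat.subsingleton_ext_of_exists_isRegular m (ModuleCat.of R (R ⧸ m)) hsupp.le
      (ModuleCat.of R (R ⧸ I)) hlt rs hmem hreg d (by omega))

/-- The monomial ideal generated by a set of exponents. -/
noncomputable def spineMI (k : Type u) [Field k] {N : ℕ} (S : Set (Fin N →₀ ℕ)) :
    Ideal (MvPolynomial (Fin N) k) :=
  Ideal.span ((fun s => MvPolynomial.monomial s (1 : k)) '' S)

theorem spineMI_mul_mem {k : Type u} [Field k] {N : ℕ} (S : Set (Fin N →₀ ℕ)) (c : Fin N →₀ ℕ)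
    (r : MvPolynomial (Fin N) k) :
    MvPolynomial.monomial c 1 * r ∈ spineMI k S ↔ ∀ d ∈ r.support, ∃ s ∈ S, s ≤ c + d := by
  rw [spineMI, MvPolynomial.mem_ideal_span_monomial_image]
  constructor
  · intro h d hd
    apply h
    rw [MvPolynomial.mem_support_iff, MvPolynomial.coeff_monomial_mul, one_mul]
    exact MvPolynomial.mem_support_iff.1 hd
  · intro h e he
    rw [MvPolynomial.mem_support_iff, MvPolynomial.coeff_monomial_mul'] at he
    split_ifs at he with hc
    · obtain ⟨s, hs, hle⟩ := h (e - c) (by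
        rw [MvPolynomial.mem_support_iff]; simpa using he)
      exact ⟨s, hs, by rwa [add_tsub_cancel_of_le hc] at hle⟩
    · exact absurd rfl he

theorem spineMI_reg {k : Type u} [Field k] {N : ℕ} (S : Set (Fin N →₀ ℕ)) (j : Fin N)
    (hj : ∀ s ∈ S, s j = 0) (r : MvPolynomial (Fin N) k)
    (h : MvPolynomial.X j * r ∈ spineMI k S) : r ∈ spineMI k S := by
  rw [MvPolynomial.X, spineMI_mul_mem] at h
  rw [spineMI, MvPolynomial.mem_ideal_span_monomial_image]
  intro d hd
  obtain ⟨s, hs, hle⟩ := h d hd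
  refine ⟨s, hs, fun v => ?_⟩
  have := hle v
  rw [Finsupp.add_apply, Finsupp.single_apply] at this
  split_ifs at this with hv
  · subst hv; rw [hj s hs]; exact Nat.zero_le _
  · simpa using this

theorem spineMI_insert {k : Type u} [Field k] {N : ℕ} (S : Set (Fin N →₀ ℕ)) (c : Fin N →₀ ℕ) :
    spineMI k (insert c S) = spineMI k S ⊔ Ideal.span {MvPolynomial.monomial c 1} := by
  rw [spineMI, Set.image_insert_eq, Ideal.span_insert, sup_comm, spineMI]

/-- The irrelevant ideal. -/
noncomputable def spineMax (k : Type u) [Field k] (N : ℕ) : Ideal (MvPolynomial (Fin N) k) :=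
  Ideal.span (Set.range (MvPolynomial.X : Fin N → MvPolynomial (Fin N) k))

theorem spineMax_mem (k : Type u) [Field k] {N : ℕ} (j : Fin N) :
    (MvPolynomial.X j : MvPolynomial (Fin N) k) ∈ spineMax k N :=
  Ideal.subset_span ⟨j, rfl⟩

theorem spineMax_ne_top (k : Type u) [Field k] (N : ℕ) : spineMax k N ≠ ⊤ := by
  intro h
  have h1 : spineMax k N ≤ RingHom.ker (MvPolynomial.constantCoeff (σ := Fin N) (R := k)) := by
    rw [spineMax, Ideal.span_le]
    rintro _ ⟨j, rfl⟩
    simp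
  rw [h] at h1
  have : (1 : MvPolynomial (Fin N) k) ∈ RingHom.ker MvPolynomial.constantCoeff := h1 trivial
  simp [RingHom.mem_ker] at this

/-- Combined step for monomial ideals. -/
theorem spineMI_step {k : Type u} [Field k] {N : ℕ} (S T : Set (Fin N →₀ ℕ)) (j : Fin N)
    (g : Fin N →₀ ℕ) (hj : ∀ s ∈ S, s j = 0)
    (hT : ∀ d, (∃ t ∈ T, t ≤ d) ↔ ∃ s ∈ S, s ≤ (Finsupp.single j 1 + g) + d) {d₁ d₂ : ℕ}
    (h1 : SpineHD (spineMax k N) (spineMI k S) d₁)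
    (h2 : SpineHD (spineMax k N) (spineMI k T) (d₂ + 1)) :
    SpineHD (spineMax k N) (spineMI k (insert (Finsupp.single j 1 + g) S)) (min d₁ d₂) := by
  have hm : (MvPolynomial.monomial (Finsupp.single j 1 + g) (1 : k)) =
      MvPolynomial.X j * MvPolynomial.monomial g 1 := by
    rw [MvPolynomial.X, MvPolynomial.monomial_mul, one_mul]
  rw [spineMI_insert, hm]
  refine spine_step _ _ (spineMI k T) _ _ (spineMax_mem k j) (spineMI_reg S j hj) ?_ h1 h2
  intro r
  rw [← hm, spineMI_mul_mem]
  rw [spineMI, MvPolynomial.mem_ideal_span_monomial_image]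
  exact forall₂_congr fun d _ => hT d

theorem spine_hd_bot (k : Type u) [Field k] (N : ℕ) :
    SpineHD (spineMax k N) (spineMI k (∅ : Set (Fin N →₀ ℕ))) N := by
  let V : ℕ → Set (Fin N →₀ ℕ) := fun j => {s | ∃ v : Fin N, (v : ℕ) < j ∧ s = Finsupp.single v 1}
  have key : ∀ i ≤ N, SpineHD (spineMax k N) (spineMI k (V (N - i))) i := by
    intro i
    induction i with
    | zero =>
      intro _
      have : spineMI k (V (N - 0)) = spineMax k N := by
        rw [spineMI, spineMax]
        congr 1
        ext p
        constructor
        · rintro ⟨_, ⟨v, _, rfl⟩, rfl⟩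
          exact ⟨v, rfl⟩
        · rintro ⟨v, rfl⟩
          exact ⟨_, ⟨v, v.2, rfl⟩, rfl⟩
      rw [this]
      exact spine_hd_self _ (spineMax_ne_top k N)
    | succ i ih =>
      intro hi
      have hlt : N - (i + 1) < N := by omega
      have hV : V (N - i) = insert (Finsupp.single ⟨N - (i + 1), hlt⟩ 1) (V (N - (i + 1))) := by
        ext s
        constructor
        · rintro ⟨v, hv, rfl⟩
          by_cases h : (v : ℕ) = N - (i + 1)
          · left; congr 1; exact Fin.ext h
          · right; exact ⟨v, by omega, rfl⟩
        · rintro (rfl | ⟨v, hv, rfl⟩)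
          · exact ⟨_, by simp only; omega, rfl⟩
          · exact ⟨v, by omega, rfl⟩
      have h := ih (by omega)
      rw [hV, spineMI_insert] at h
      refine spine_step_back _ _ _ (spineMax_mem k ⟨N - (i + 1), hlt⟩)
        (spineMI_reg _ _ ?_) h
      rintro _ ⟨v, hv, rfl⟩
      rw [Finsupp.single_apply, if_neg]
      rintro rfl
      simp at hv
  have h := key N le_rfl
  have hV : V (N - N) = ∅ := by
    ext s; simp [V]
  rwa [hV] at h

/-- Exponent of the product of the variables with index in `[a, b)`. -/
noncomputable def spineW (N a b : ℕ) : Fin N →₀ ℕ :=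
  Finsupp.equivFunOnFinite.symm fun v => if a ≤ (v : ℕ) ∧ (v : ℕ) < b then 1 else 0

theorem spineW_apply (N a b : ℕ) (v : Fin N) :
    spineW N a b v = if a ≤ (v : ℕ) ∧ (v : ℕ) < b then 1 else 0 := rfl

/-- Exponents of the generators of the path ideal on the first `n` variables. -/
def spineS (N ℓ n : ℕ) : Set (Fin N →₀ ℕ) := {s | ∃ a, a + ℓ < n ∧ s = spineW N a (a + ℓ + 1)}

theorem spineS_small (N ℓ n : ℕ) (h : n ≤ ℓ) : spineS N ℓ n = ∅ := by
  ext s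
  simp only [spineS, Set.mem_setOf_eq, Set.mem_empty_iff_false, iff_false]
  rintro ⟨a, ha, -⟩
  omega

theorem spineS_succ (N ℓ n : ℕ) (h : ℓ ≤ n) (hn : n < N) :
    spineS N ℓ (n + 1) =
      insert (Finsupp.single ⟨n, hn⟩ 1 + spineW N (n - ℓ) n) (spineS N ℓ n) := by
  have hw : Finsupp.single ⟨n, hn⟩ 1 + spineW N (n - ℓ) n = spineW N (n - ℓ) (n - ℓ + ℓ + 1) := by
    ext v
    rw [Finsupp.add_apply, Finsupp.single_apply, spineW_apply, spineW_apply]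
    have : (⟨n, hn⟩ : Fin N) = v ↔ n = (v : ℕ) := by rw [Fin.ext_iff]
    simp only [this]
    split_ifs <;> omega
  rw [hw]
  ext s
  constructor
  · rintro ⟨a, ha, rfl⟩
    by_cases h' : a = n - ℓ
    · left; rw [h']
    · right; exact ⟨a, by omega, rfl⟩
  · rintro (rfl | ⟨a, ha, rfl⟩)
    · exact ⟨_, by omega, rfl⟩
    · exact ⟨a, by omega, rfl⟩

theorem spineS_zero (N ℓ n : ℕ) (j : Fin N) (h : n ≤ j) : ∀ s ∈ spineS N ℓ n, s j = 0 := by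
  rintro _ ⟨a, ha, rfl⟩
  rw [spineW_apply, if_neg (by omega)]

theorem spine_colon (N ℓ n : ℕ) (h : ℓ + 1 ≤ n) (hn : n < N) (hj : n - ℓ - 1 < N)
    (d : Fin N →₀ ℕ) :
    (∃ t ∈ insert (Finsupp.single ⟨n - ℓ - 1, hj⟩ 1) (spineS N ℓ (n - ℓ - 1)), t ≤ d) ↔
      ∃ s ∈ spineS N ℓ n, s ≤ (Finsupp.single ⟨n, hn⟩ 1 + spineW N (n - ℓ) n) + d := by
  constructor
  · rintro ⟨t, rfl | ⟨a, ha, rfl⟩, hle⟩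
    · refine ⟨_, ⟨n - ℓ - 1, by omega, rfl⟩, fun v => ?_⟩
      have h1 := hle v
      rw [Finsupp.single_apply] at h1
      rw [Finsupp.add_apply, Finsupp.add_apply, Finsupp.single_apply, spineW_apply, spineW_apply]
      have h2 : (⟨n - ℓ - 1, hj⟩ : Fin N) = v ↔ n - ℓ - 1 = (v : ℕ) := by rw [Fin.ext_iff]
      simp only [h2] at h1
      split_ifs at h1 ⊢ <;> omega
    · exact ⟨_, ⟨a, by omega, rfl⟩, hle.trans le_add_self⟩
  · rintro ⟨_, ⟨a, ha, rfl⟩, hle⟩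
    by_cases h1 : a + ℓ < n - ℓ - 1
    · refine ⟨_, Or.inr ⟨a, h1, rfl⟩, fun v => ?_⟩
      have h2 := hle v
      rw [Finsupp.add_apply, Finsupp.add_apply, Finsupp.single_apply, spineW_apply,
        spineW_apply] at h2
      rw [spineW_apply]
      have h3 : (⟨n, hn⟩ : Fin N) = v ↔ n = (v : ℕ) := by rw [Fin.ext_iff]
      simp only [h3] at h2
      split_ifs at h2 ⊢ <;> omega
    · refine ⟨_, Or.inl rfl, fun v => ?_⟩
      have h2 := hle v
      rw [Finsupp.add_apply, Finsupp.add_apply, Finsupp.single_apply, spineW_apply,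
        spineW_apply] at h2
      rw [Finsupp.single_apply]
      have h3 : (⟨n, hn⟩ : Fin N) = v ↔ n = (v : ℕ) := by rw [Fin.ext_iff]
      have h4 : (⟨n - ℓ - 1, hj⟩ : Fin N) = v ↔ n - ℓ - 1 = (v : ℕ) := by rw [Fin.ext_iff]
      simp only [h3] at h2
      simp only [h4]
      split_ifs at h2 ⊢ <;> omega

/-- The projective dimension. -/
def spinePd (ℓ n : ℕ) : ℕ := 2 * (n / (ℓ + 2)) + if n % (ℓ + 2) = ℓ + 1 then 1 else 0

theorem spinePd_eq (ℓ b r : ℕ) (hr : r < ℓ + 2) :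
    spinePd ℓ (b * (ℓ + 2) + r) = 2 * b + if r = ℓ + 1 then 1 else 0 := by
  rw [spinePd, add_comm (b * (ℓ + 2)), Nat.add_mul_mod_self_right, Nat.mod_eq_of_lt hr,
    Nat.add_mul_div_right _ _ (by omega), Nat.div_eq_of_lt hr, zero_add]

theorem spinePd_small (ℓ n : ℕ) (h : n ≤ ℓ) : spinePd ℓ n = 0 := by
  have := spinePd_eq ℓ 0 n (by omega)
  rw [if_neg (by omega)] at this
  simpa using this

theorem spinePd_one (ℓ : ℕ) : spinePd ℓ (ℓ + 1) = 1 := by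
  have := spinePd_eq ℓ 0 (ℓ + 1) (by omega)
  simpa using this

theorem spinePd_add (ℓ n : ℕ) : spinePd ℓ (n + (ℓ + 2)) = spinePd ℓ n + 2 := by
  rw [spinePd, spinePd, Nat.add_mod_right, Nat.add_div_right _ (by omega)]
  split_ifs <;> omega

theorem spinePd_mono (ℓ n : ℕ) :
    spinePd ℓ n ≤ spinePd ℓ (n + 1) ∧ spinePd ℓ (n + 1) ≤ spinePd ℓ n + 1 := by
  induction n using Nat.strong_induction_on with
  | _ n ih =>
    by_cases h : n < ℓ
    · rw [spinePd_small _ _ (by omega), spinePd_small _ _ (by omega)]; omega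
    by_cases h1 : n = ℓ
    · subst h1; rw [spinePd_small _ _ (by omega), spinePd_one]; omega
    by_cases h2 : n = ℓ + 1
    · subst h2
      rw [spinePd_one, show ℓ + 1 + 1 = 0 + (ℓ + 2) by omega, spinePd_add,
        spinePd_small _ _ (by omega)]; omega
    have := ih (n - (ℓ + 2)) (by omega)
    rw [show n = n - (ℓ + 2) + (ℓ + 2) by omega, spinePd_add, add_right_comm, spinePd_add]
    omega

theorem spinePd_le (ℓ n : ℕ) : spinePd ℓ n ≤ n := by
  induction n with
  | zero => rw [spinePd_small _ _ (by omega)]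
  | succ n ih => have := (spinePd_mono ℓ n).2; omega

theorem spine_main (k : Type u) [Field k] (N ℓ n : ℕ) (hn : n ≤ N) :
    SpineHD (spineMax k N) (spineMI k (spineS N ℓ n)) (N - spinePd ℓ n) := by
  induction n using Nat.strong_induction_on with
  | _ n ih =>
    by_cases h : n ≤ ℓ
    · rw [spineS_small _ _ _ h, spinePd_small _ _ h]
      exact spine_hd_bot k N
    obtain ⟨n, rfl⟩ : ∃ n', n = n' + 1 := ⟨n - 1, by omega⟩
    have hnN : n < N := by omega
    have hB := ih n (by omega) (by omega)
    rw [spineS_succ N ℓ n (by omega) hnN]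
    by_cases h1 : n = ℓ
    · have hA := spine_hd_bot k N
      have hN : N = N - 1 + 1 := by omega
      rw [hN] at hA
      have hs := spineMI_step (k := k) (spineS N ℓ n) ∅ ⟨n, hnN⟩ (spineW N (n - ℓ) n)
        (spineS_zero N ℓ n _ le_rfl) (by
          intro d
          rw [spineS_small _ _ _ (by omega)]; simp) hB (d₂ := N - 1) (by
            have hA := spine_hd_bot k N
            rwa [show N - 1 + 1 = N by omega])
      have : min (N - spinePd ℓ n) (N - 1) = N - spinePd ℓ (n + 1) := by
        subst h1
        rw [spinePd_one, spinePd_small _ _ le_rfl]; omega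
      rwa [this] at hs
    · have hj : n - ℓ - 1 < N := by omega
      have hA := ih (n - ℓ - 1) (by omega) (by omega)
      have hp := spinePd_le ℓ (n - ℓ - 1)
      have hpm := spinePd_mono ℓ n
      have hpa := spinePd_add ℓ (n - ℓ - 1)
      rw [show n - ℓ - 1 + (ℓ + 2) = n + 1 by omega] at hpa
      have hple := spinePd_le ℓ (n + 1)
      have hJ := spineMI_step (k := k) (spineS N ℓ (n - ℓ - 1)) (spineS N ℓ (n - ℓ - 1))
        ⟨n - ℓ - 1, hj⟩ 0 (spineS_zero N ℓ _ _ le_rfl) (by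
          intro d
          constructor
          · rintro ⟨t, ht, hle⟩
            exact ⟨t, ht, hle.trans le_add_self⟩
          · rintro ⟨t, ht, hle⟩
            refine ⟨t, ht, fun v => ?_⟩
            have h2 := hle v
            rw [add_zero, Finsupp.add_apply, Finsupp.single_apply] at h2
            split_ifs at h2 with hv
            · subst hv
              rw [spineS_zero N ℓ _ _ le_rfl t ht]; exact Nat.zero_le _
            · simpa using h2) hA (d₂ := N - spinePd ℓ (n - ℓ - 1) - 1) (by
            rwa [show N - spinePd ℓ (n - ℓ - 1) - 1 + 1 = N - spinePd ℓ (n - ℓ - 1) by omega])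
      rw [add_zero] at hJ
      have hs := spineMI_step (k := k) (spineS N ℓ n) _ ⟨n, hnN⟩ (spineW N (n - ℓ) n)
        (spineS_zero N ℓ n _ le_rfl) (spine_colon N ℓ n (by omega) hnN hj) hB
        (d₂ := N - spinePd ℓ (n + 1)) (by
          convert hJ using 1
          omega)
      have : min (N - spinePd ℓ n) (N - spinePd ℓ (n + 1)) = N - spinePd ℓ (n + 1) := by omega
      rwa [this] at hs

theorem spine_ideal_eq (k : Type u) [Field k] (n ℓ : ℕ) :
    spinePathIdeal k n ℓ = spineMI k (spineS n ℓ n) := by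
  have hmon : ∀ i, (∏ v ∈ Finset.univ.filter
      (fun v : Fin n => i ≤ (v : ℕ) ∧ (v : ℕ) ≤ i + ℓ), (MvPolynomial.X v : MvPolynomial (Fin n) k))
      = MvPolynomial.monomial (spineW n i (i + ℓ + 1)) 1 := by
    intro i
    rw [MvPolynomial.monomial_eq, Finsupp.prod_fintype _ _ (by simp), Finset.prod_filter]
    simp only [map_one, one_mul]
    refine Finset.prod_congr rfl fun v _ => ?_
    rw [spineW_apply]
    simp only [Nat.lt_succ_iff]
    split_ifs <;> simp
  rw [spinePathIdeal, spineMI]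
  congr 1
  ext p
  constructor
  · rintro ⟨i, hi, rfl⟩
    exact ⟨_, ⟨i, hi, rfl⟩, (hmon i).symm⟩
  · rintro ⟨_, ⟨i, hi, rfl⟩, rfl⟩
    exact ⟨i, hi, hmon i⟩

theorem spine_ideal_le (k : Type u) [Field k] (n ℓ : ℕ) :
    spinePathIdeal k n ℓ ≤ spineMax k n := by
  rw [spinePathIdeal, Ideal.span_le]
  rintro _ ⟨i, hi, rfl⟩
  have hi' : i + ℓ < n := hi
  refine Ideal.mem_of_dvd _ (Finset.dvd_prod_of_mem _ (a := (⟨i, by omega⟩ : Fin n)) ?_)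
    (spineMax_mem k _)
  simp

theorem spine_depth (k : Type u) [Field k] (n ℓ : ℕ) :
    quotientDepth k (spinePathIdeal k n ℓ) = n - spinePd ℓ n := by
  have h := spine_main k n ℓ n le_rfl
  rw [← spine_ideal_eq] at h
  exact spine_rees (spineMax k n) _ (spineMax_ne_top k n) (spine_ideal_le k n ℓ) h

/-- Depth of the path ideal of a spine: writing `n = (ℓ+1) + b(ℓ+2) + c` with
`0 ≤ c < ℓ+2`, one has `depth (R/P_ℓ(S_n)) = ℓ(b+1)` if `c = 0` and
`depth (R/P_ℓ(S_n)) = ℓ(b+1) + c - 1` if `c > 0`. -/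
theorem depth_spinePathIdeal (k : Type*) [Field k] (n ℓ : ℕ) (hℓ : 1 ≤ ℓ)
    (b : ℤ) (c : ℕ) (hc : c < ℓ + 2)
    (hn : (n : ℤ) = (ℓ + 1) + b * (ℓ + 2) + c) :
    (quotientDepth k (spinePathIdeal k n ℓ) : ℤ) =
      if c = 0 then ℓ * (b + 1) else ℓ * (b + 1) + c - 1 := by
  have hle := spinePd_le ℓ n
  rw [spine_depth, Nat.cast_sub hle]
  have hb : -1 ≤ b := by
    by_contra hb
    have h1 : b + 2 ≤ 0 := by omega
    have h2 : (b + 2) * ((ℓ : ℤ) + 2) ≤ 0 := mul_nonpos_of_nonpos_of_nonneg h1 (by positivity)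
    have h3 : (c : ℤ) < ℓ + 2 := by exact_mod_cast hc
    have h4 : (0 : ℤ) ≤ n := by positivity
    nlinarith
  split_ifs with h0
  · subst h0
    have hb0 : 0 ≤ b := by
      by_contra hb0
      have : b = -1 := by omega
      subst this
      have h4 : (0 : ℤ) ≤ n := by positivity
      push_cast at hn
      linarith
    obtain ⟨b, rfl⟩ := Int.eq_ofNat_of_zero_le hb0
    have hn' : n = b * (ℓ + 2) + (ℓ + 1) := by
      zify; rw [hn]; push_cast; ring
    have hp := spinePd_eq ℓ b (ℓ + 1) (by omega)
    rw [← hn', if_pos rfl] at hp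
    rw [hp, hn]; push_cast; ring
  · obtain ⟨b', hb'⟩ := Int.eq_ofNat_of_zero_le (show 0 ≤ b + 1 by omega)
    have hbe : b = b' - 1 := by omega
    subst hbe
    obtain ⟨c, rfl⟩ : ∃ c', c = c' + 1 := ⟨c - 1, by omega⟩
    have hn' : n = b' * (ℓ + 2) + c := by
      zify; rw [hn]; push_cast; ring
    have hp := spinePd_eq ℓ b' c (by omega)
    rw [← hn', if_neg (by omega)] at hp
    rw [hp, hn]; push_cast; ring
end

section
/- Let S_n be the path graph on n vertices and P_ℓ(S_n) the ideal of ℓ+1 consecutive variable products in R = k[x_1,...,x_n]. Then depth(R/P_ℓ(S_n)) = Σ_{i=0}^{ℓ-1} ⌈(n-i)/(ℓ+2)⌉. -/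
/-- Weak regularity of a sequence modulo an ideal, elementwise. -/
def WR {R : Type*} [CommRing R] : Ideal R → List R → Prop
  | _, [] => True
  | J, f :: fs => (∀ g, f * g ∈ J → g ∈ J) ∧ WR (J ⊔ Ideal.span {f}) fs

section General
variable {R : Type*} [CommRing R]

theorem mem_sup_sp {J : Ideal R} {f g : R} :
    g ∈ J ⊔ Ideal.span {f} ↔ ∃ a, g - a * f ∈ J := by
  rw [sup_comm, Ideal.mem_span_singleton_sup]
  constructor
  · rintro ⟨a, b, hb, rfl⟩
    exact ⟨a, by simpa using hb⟩
  · rintro ⟨a, h⟩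
    exact ⟨a, _, h, by ring⟩

theorem isWeaklyRegular_iff_WR (rs : List R) : ∀ J : Ideal R,
    RingTheory.Sequence.IsWeaklyRegular (R ⧸ J) rs ↔ WR J rs := by
  induction rs with
  | nil => intro J; simp [WR]
  | cons f fs ih =>
    intro J
    rw [RingTheory.Sequence.isWeaklyRegular_cons_iff, WR]
    refine and_congr ?_ ?_
    · rw [isSMulRegular_iff_right_eq_zero_of_smul]
      constructor
      · intro h g hg
        have := h (Ideal.Quotient.mk J g) (by
          rw [← Ideal.Quotient.mk_eq_mk, ← Submodule.Quotient.mk_smul, Ideal.Quotient.mk_eq_mk,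
            Ideal.Quotient.eq_zero_iff_mem]
          simpa using hg)
        exact Ideal.Quotient.eq_zero_iff_mem.1 this
      · intro h x hx
        obtain ⟨g, rfl⟩ := Ideal.Quotient.mk_surjective x
        rw [← Ideal.Quotient.mk_eq_mk, ← Submodule.Quotient.mk_smul, Ideal.Quotient.mk_eq_mk,
            Ideal.Quotient.eq_zero_iff_mem] at hx
        exact Ideal.Quotient.eq_zero_iff_mem.2 (h g (by simpa using hx))
    · rw [← ih]
      refine LinearEquiv.isWeaklyRegular_congr ?_ fs
      refine (Submodule.quotEquivOfEq _ _ ?_) ≪≫ₗ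
        Submodule.quotientQuotientEquivQuotientSup J (Ideal.span {f})
      ext x
      rw [Submodule.mem_map, Submodule.mem_smul_pointwise_iff_exists]
      constructor
      · rintro ⟨y, -, rfl⟩
        obtain ⟨g, rfl⟩ := Ideal.Quotient.mk_surjective y
        exact ⟨f * g, Ideal.mul_mem_right _ _ (Ideal.mem_span_singleton_self f), rfl⟩
      · rintro ⟨y, hy, rfl⟩
        obtain ⟨g, rfl⟩ := Ideal.mem_span_singleton.1 hy
        exact ⟨Ideal.Quotient.mk J g, trivial, rfl⟩

theorem WR_top (fs : List R) : WR (⊤ : Ideal R) fs := by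
  induction fs with
  | nil => trivial
  | cons f fs ih => exact ⟨fun _ _ => trivial, by simpa using ih⟩

/-- Short exact sequence `0 → R/(J:g) → R/J → R/(J+g) → 0`. -/
theorem WR_filt (g : R) (fs : List R) : ∀ (J K : Ideal R),
    (∀ a, a ∈ K ↔ g * a ∈ J) → WR K fs → WR (J ⊔ Ideal.span {g}) fs → WR J fs := by
  induction fs with
  | nil => intros; trivial
  | cons f fs ih =>
    rintro J K hK ⟨h1, h2⟩ ⟨h3, h4⟩
    have key : ∀ h, f * h ∈ J → h ∈ J := by
      intro h hh
      obtain ⟨a, ha⟩ := mem_sup_sp.1 (h3 h (Ideal.mem_sup_left hh))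
      have : f * a ∈ K := by
        rw [hK]
        have := J.sub_mem hh (J.mul_mem_left f ha)
        convert this using 1; ring
      have := (hK a).1 (h1 a this)
      have := J.add_mem ha this
      convert this using 1; ring
    refine ⟨key, ih _ (K ⊔ Ideal.span {f}) ?_ h2 ?_⟩
    · intro a
      constructor
      · intro ha
        obtain ⟨b, hb⟩ := mem_sup_sp.1 ha
        refine mem_sup_sp.2 ⟨g * b, ?_⟩
        have := (hK _).1 hb
        convert this using 1; ring
      · intro ha
        obtain ⟨b, hb⟩ := mem_sup_sp.1 ha
        have : b ∈ J ⊔ Ideal.span {g} := by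
          apply h3
          refine mem_sup_sp.2 ⟨a, ?_⟩
          have := J.neg_mem hb
          convert this using 1; ring
        obtain ⟨c, hc⟩ := mem_sup_sp.1 this
        refine mem_sup_sp.2 ⟨c, ?_⟩
        rw [hK]
        have := J.add_mem hb (J.mul_mem_left f hc)
        convert this using 1; ring
    · rwa [sup_right_comm]

/-- Every regular sequence lying in a prime `m` has length at most the coheight of any
associated prime contained in `m`. -/
theorem WR_length_le [IsNoetherianRing R] (m : Ideal R) [hm : m.IsPrime] (rs : List R) :
    ∀ (J : Ideal R) (p : PrimeSpectrum R) (y : R), (∀ a, a ∈ p.asIdeal ↔ a * y ∈ J) →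
      p.asIdeal ≤ m → (∀ r ∈ rs, r ∈ m) → WR J rs →
      (rs.length : ℕ∞) ≤ Order.coheight p := by
  induction rs with
  | nil => intros; simp
  | cons x rs ih =>
    rintro J p y hp hpm hrs ⟨hx, hrs'⟩
    have hxm : x ∈ m := hrs x (by simp)
    -- step 1: find `z` with `J : z = p` and `(J + x) : z ≤ m`
    obtain ⟨z, hz, hz'⟩ : ∃ z, (∀ a, a ∈ p.asIdeal ↔ a * z ∈ J) ∧
        ∀ s, s * z ∈ J ⊔ Ideal.span {x} → s ∈ m := by
      let A : R → Ideal R := fun y =>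
        { carrier := {r | ∃ s, s ∉ m ∧ s * r ∈ J ⊔ Ideal.span {y}}
          add_mem' := by
            rintro a b ⟨s, hs, h⟩ ⟨t, ht, h'⟩
            refine ⟨s * t, fun h => (hm.mem_or_mem h).elim hs ht, ?_⟩
            have := Ideal.add_mem _ (Ideal.mul_mem_left _ t h) (Ideal.mul_mem_left _ s h')
            convert this using 1; ring
          zero_mem' := ⟨1, hm.one_notMem, by simp⟩
          smul_mem' := by
            rintro c a ⟨s, hs, h⟩
            refine ⟨s, hs, ?_⟩
            have := Ideal.mul_mem_left _ c h
            convert this using 1; simp only [smul_eq_mul]; ring }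
      have hA : ∀ y r, r ∈ A y ↔ ∃ s, s ∉ m ∧ s * r ∈ J ⊔ Ideal.span {y} := fun _ _ => Iff.rfl
      let S : Set (Ideal R) := {I | ∃ z, (∀ a, a ∈ p.asIdeal ↔ a * z ∈ J) ∧ I = A z}
      obtain ⟨I, ⟨z, hz, rfl⟩, hmax⟩ :=
        set_has_maximal_iff_noetherian.2 (inferInstanceAs (IsNoetherian R R)) S ⟨_, y, hp, rfl⟩
      refine ⟨z, hz, fun s hs => ?_⟩
      by_contra hsm
      obtain ⟨y1, hy1⟩ := mem_sup_sp.1 hs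
      have hsp : s ∉ p.asIdeal := fun h => hsm (hpm h)
      have hy1' : ∀ a, a ∈ p.asIdeal ↔ a * y1 ∈ J := by
        intro a
        constructor
        · intro ha
          apply hx
          have := J.sub_mem (J.mul_mem_left s ((hz a).1 ha)) (J.mul_mem_left a hy1)
          convert this using 1; ring
        · intro ha
          have : s * a ∈ p.asIdeal := by
            rw [hz]
            have := J.add_mem (J.mul_mem_left a hy1) (J.mul_mem_left x ha)
            convert this using 1; ring
          exact (p.2.mem_or_mem this).resolve_left hsp
      have hle : A z ≤ A y1 := by
        rintro r ⟨s', hs', h⟩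
        obtain ⟨b, hb⟩ := mem_sup_sp.1 h
        refine ⟨s * s', fun h => (hm.mem_or_mem h).elim hsm hs', mem_sup_sp.2 ⟨b * x, ?_⟩⟩
        have := J.add_mem (J.mul_mem_left s hb) (J.mul_mem_left b hy1)
        convert this using 1; ring
      have heq : A y1 ≤ A z := by
        by_contra hne
        exact hmax (A y1) ⟨y1, hy1', rfl⟩ (lt_of_le_not_ge hle hne)
      obtain ⟨s', hs', h⟩ := (hA z y1).1 (heq ((hA y1 y1).2 ⟨1, hm.one_notMem, by
        rw [one_mul]; exact Ideal.mem_sup_right (Ideal.mem_span_singleton_self _)⟩))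
      obtain ⟨b, hb⟩ := mem_sup_sp.1 h
      have : s * s' - b * x ∈ p.asIdeal := by
        rw [hy1']
        have := J.add_mem (J.mul_mem_left s hb) (J.mul_mem_left b hy1)
        convert this using 1; ring
      have : s * s' ∈ m := by
        have := m.add_mem (hpm this) (m.mul_mem_left b hxm)
        simpa using this
      exact (hm.mem_or_mem this).elim hsm hs'
    -- step 2: find a prime `(J + x) : w`
    let J' := J ⊔ Ideal.span {x}
    let Q : R → Ideal R := fun w =>
      { carrier := {a | a * w ∈ J'}
        add_mem' := by
          intro a b ha hb
          simp only [Set.mem_ofPred_eq] at *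
          rw [add_mul]; exact J'.add_mem ha hb
        zero_mem' := by simp
        smul_mem' := by
          intro c a ha
          simp only [Set.mem_ofPred_eq, smul_eq_mul] at *
          rw [mul_assoc]; exact J'.mul_mem_left c ha }
    have hQ : ∀ w a, a ∈ Q w ↔ a * w ∈ J' := fun _ _ => Iff.rfl
    let S : Set (Ideal R) := {I | ∃ w, p.asIdeal ≤ Q w ∧ Q w ≤ m ∧ I = Q w}
    obtain ⟨I, ⟨w, hpw, hwm, rfl⟩, hmax⟩ :=
        set_has_maximal_iff_noetherian.2 (inferInstanceAs (IsNoetherian R R)) S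
          ⟨_, z, fun a ha => Ideal.mem_sup_left ((hz a).1 ha), fun a ha => hz' a ha, rfl⟩
    have hmono : ∀ s, Q w ≤ Q (s * w) := by
      intro s a ha
      rw [hQ] at *
      have := J'.mul_mem_left s ha
      convert this using 1; ring
    have hkey : ∀ s, Q (s * w) ≤ m → Q (s * w) ≤ Q w := by
      intro s hs
      by_contra hne
      exact hmax _ ⟨s * w, hpw.trans (hmono s), hs, rfl⟩ (lt_of_le_not_ge (hmono s) hne)
    have hprime : (Q w).IsPrime := by
      refine ⟨fun h => hm.ne_top (top_le_iff.1 (h ▸ hwm)), ?_⟩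
      intro a b hab
      by_contra hcon
      push Not at hcon
      obtain ⟨ha, hb⟩ := hcon
      by_cases h : Q (a * w) ≤ m
      · apply hb
        apply hkey a h
        rw [hQ] at *
        convert hab using 1; ring
      · obtain ⟨s, hs, hsm⟩ := SetLike.not_le_iff_exists.1 h
        apply ha
        apply hkey s
        · intro t ht
          have : t * s ∈ m := hwm (by rw [hQ] at *; convert ht using 1; ring)
          exact (hm.mem_or_mem this).resolve_right hsm
        · rw [hQ] at *
          convert hs using 1; ring
    have hxp : x ∉ p.asIdeal := by
      intro h
      have := hx _ ((hz x).1 h)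
      exact p.2.one_notMem ((hz 1).2 (by simpa using this))
    have hlt : p < (⟨Q w, hprime⟩ : PrimeSpectrum R) := by
      refine lt_of_le_of_ne hpw fun h => hxp ?_
      rw [h]
      exact J'.mul_mem_right w (Ideal.mem_sup_right (Ideal.mem_span_singleton_self _))
    have := ih J' ⟨Q w, hprime⟩ w (fun a => Iff.rfl) hwm
      (fun r hr => hrs r (List.mem_cons_of_mem _ hr)) hrs'
    calc ((x :: rs).length : ℕ∞) = rs.length + 1 := by simp
      _ ≤ _ := add_le_add_left this 1
      _ ≤ _ := Order.coheight_add_one_le hlt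

end General

section Poly
open MvPolynomial
variable {k : Type*} [Field k] {σ : Type*}

attribute [local instance] MvPolynomial.gradedAlgebra

theorem homogeneous_sup_span {J : Ideal (MvPolynomial σ k)}
    (hJ : J.IsHomogeneous (homogeneousSubmodule σ k)) {f : MvPolynomial σ k} {d : ℕ}
    (hf : f.IsHomogeneous d) :
    (J ⊔ Ideal.span {f}).IsHomogeneous (homogeneousSubmodule σ k) := by
  refine Ideal.IsHomogeneous.sup hJ (Ideal.homogeneous_span _ _ ?_)
  rintro x rfl
  exact ⟨d, hf⟩

theorem mem_of_forall_pow {J : Ideal (MvPolynomial σ k)}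
    (hJ : J.IsHomogeneous (homogeneousSubmodule σ k)) (v : σ) (g : MvPolynomial σ k)
    (h : ∀ e : ℕ, ∃ a, g - X v ^ e * a ∈ J) : g ∈ J := by
  rw [mem_iff_homogeneousComponent_mem hJ]
  intro d
  obtain ⟨a, ha⟩ := h (d + 1)
  have h1 := homogeneousComponent_mem_of_mem hJ ha d
  have h2 : homogeneousComponent d (X v ^ (d + 1) * a) = 0 := by
    ext u
    rw [coeff_homogeneousComponent, coeff_zero]
    split_ifs with hu
    · rw [X_pow_eq_monomial, coeff_monomial_mul', if_neg]
      intro hle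
      have h3 := hle v
      rw [Finsupp.single_eq_same] at h3
      have := Finsupp.le_degree v u
      omega
    · rfl
  rwa [map_sub, h2, sub_zero] at h1

theorem WR_deform (v : σ) (fs : List (MvPolynomial σ k)) :
    ∀ (J : Ideal (MvPolynomial σ k)), J.IsHomogeneous (homogeneousSubmodule σ k) →
    (∀ g, X v * g ∈ J → g ∈ J) → (∀ f ∈ fs, ∃ d, f.IsHomogeneous d) →
    WR (J ⊔ Ideal.span {X v}) fs → WR J fs := by
  induction fs with
  | nil => intros; trivial
  | cons f fs ih =>
    rintro J hJ hv hfs ⟨h1, h2⟩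
    obtain ⟨d, hd⟩ := hfs f (by simp)
    refine ⟨?_, ih _ (homogeneous_sup_span hJ hd) ?_ (fun f hf => hfs f (by simp [hf])) ?_⟩
    · intro g hg
      apply mem_of_forall_pow hJ v
      intro e
      have hve : ∀ e g, X v ^ e * g ∈ J → g ∈ J := by
        intro e
        induction e with
        | zero => intro g hg; simpa using hg
        | succ e ihe =>
          intro g hg
          apply ihe
          apply hv
          convert hg using 1; ring
      induction e with
      | zero => exact ⟨g, by simp⟩
      | succ e ihe =>
        obtain ⟨a, ha⟩ := ihe
        have h3 : f * a ∈ J := by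
          apply hve e
          have := J.sub_mem hg (J.mul_mem_left f ha)
          convert this using 1; ring
        obtain ⟨b, hb⟩ := mem_sup_sp.1 (h1 a (Ideal.mem_sup_left h3))
        refine ⟨b, ?_⟩
        have := J.add_mem ha (J.mul_mem_left (X v ^ e) hb)
        convert this using 1; ring
    · intro g hg
      obtain ⟨a, ha⟩ := mem_sup_sp.1 hg
      have h3 : a ∈ J ⊔ Ideal.span {X v} := by
        apply h1
        refine mem_sup_sp.2 ⟨g, ?_⟩
        have := J.neg_mem ha
        convert this using 1; ring
      obtain ⟨b, hb⟩ := mem_sup_sp.1 h3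
      refine mem_sup_sp.2 ⟨b, hv _ ?_⟩
      have := J.add_mem ha (J.mul_mem_left f hb)
      convert this using 1; ring
    · rwa [sup_right_comm]

variable (k) in
/-- The monomial prime generated by the variables in `C`. -/
noncomputable def PC (C : Finset σ) : Ideal (MvPolynomial σ k) :=
  Ideal.span (X '' (C : Set σ))

theorem mem_PC {C : Finset σ} {f : MvPolynomial σ k} :
    f ∈ PC k C ↔ ∀ u ∈ f.support, ∃ i ∈ C, u i ≠ 0 := by
  rw [PC, mem_ideal_span_X_image]; rfl

theorem PC_homogeneous (C : Finset σ) :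
    (PC k C).IsHomogeneous (homogeneousSubmodule σ k) := by
  refine Ideal.homogeneous_span _ _ ?_
  rintro _ ⟨v, -, rfl⟩
  exact ⟨1, isHomogeneous_X k v⟩

theorem X_mem_PC {C : Finset σ} {v : σ} : (X v : MvPolynomial σ k) ∈ PC k C ↔ v ∈ C := by
  classical
  rw [mem_PC, support_X]
  simp only [Finset.mem_singleton, forall_eq, Finsupp.single_apply]
  constructor
  · rintro ⟨i, hi, h⟩
    by_cases hvi : v = i
    · exact hvi ▸ hi
    · simp [hvi] at h
  · intro h
    exact ⟨v, h, by simp⟩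

theorem PC_prime (C : Finset σ) : (PC k C).IsPrime := by
  classical
  let φ : MvPolynomial σ k →ₐ[k] MvPolynomial σ k :=
    aeval (fun v => if v ∈ C then 0 else X v)
  have h1 : ∀ f, f - φ f ∈ PC k C := by
    intro f
    induction f using MvPolynomial.induction_on with
    | C a => simp [φ]
    | add p q hp hq =>
      rw [map_add, add_sub_add_comm]; exact Ideal.add_mem _ hp hq
    | mul_X p v hp =>
      have h2 : (X v : MvPolynomial σ k) - φ (X v) ∈ PC k C := by
        simp only [φ, aeval_X]
        split_ifs with h
        · rw [sub_zero]; exact X_mem_PC.2 h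
        · simp
      have := Ideal.add_mem _ (Ideal.mul_mem_left _ (X v) hp) (Ideal.mul_mem_left _ (φ p) h2)
      rw [map_mul]
      convert this using 1; ring
  have h2 : PC k C = RingHom.ker φ := by
    apply le_antisymm
    · rw [PC, Ideal.span_le]
      rintro _ ⟨v, hv, rfl⟩
      simp only [SetLike.mem_coe, RingHom.mem_ker]
      simp only [φ, aeval_X]
      exact if_pos hv
    · intro f hf
      have := h1 f
      rw [RingHom.mem_ker] at hf
      rwa [hf, sub_zero] at this
  rw [h2]
  exact RingHom.ker_isPrime _

theorem PC_sup [DecidableEq σ] (C : Finset σ) (v : σ) :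
    PC k C ⊔ Ideal.span {X v} = PC k (insert v C) := by
  rw [PC, PC, ← Ideal.span_union, Finset.coe_insert, Set.image_insert_eq, Set.union_singleton]

variable (k) in
/-- Elementary symmetric polynomial in the variables of `B`. -/
noncomputable def eB (B : Finset σ) (j : ℕ) : MvPolynomial σ k :=
  ∑ S ∈ B.powersetCard j, ∏ v ∈ S, X v

theorem eB_homogeneous (B : Finset σ) (j : ℕ) : (eB k B j).IsHomogeneous j := by
  refine IsHomogeneous.sum _ _ _ ?_
  intro S hS
  have := IsHomogeneous.prod S (fun v => (X v : MvPolynomial σ k)) (fun _ => 1)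
    (fun v _ => isHomogeneous_X k v)
  simpa [(Finset.mem_powersetCard.1 hS).2] using this

variable (k) in
noncomputable def seqB (B : Finset σ) : ℕ → List (MvPolynomial σ k)
  | 0 => []
  | t + 1 => eB k B (t + 1) :: seqB B t

variable (k) in
noncomputable def seqL : List (Finset σ × ℕ) → List (MvPolynomial σ k)
  | [] => []
  | (B, t) :: L => seqB k B t ++ seqL L

theorem length_seqB (B : Finset σ) (t : ℕ) : (seqB k B t).length = t := by
  induction t with
  | zero => rfl
  | succ t ih => simp [seqB, ih]

theorem length_seqL (L : List (Finset σ × ℕ)) :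
    (seqL k L).length = (L.map Prod.snd).sum := by
  induction L with
  | nil => rfl
  | cons a L ih => obtain ⟨B, t⟩ := a; simp [seqL, ih, length_seqB]

theorem seqB_homogeneous (B : Finset σ) (t : ℕ) :
    ∀ f ∈ seqB k B t, ∃ d, 1 ≤ d ∧ f.IsHomogeneous d := by
  induction t with
  | zero => simp [seqB]
  | succ t ih =>
    intro f hf
    rcases List.mem_cons.1 hf with rfl | hf
    · exact ⟨t + 1, by omega, eB_homogeneous B _⟩
    · exact ih f hf

theorem seqL_homogeneous (L : List (Finset σ × ℕ)) :
    ∀ f ∈ seqL k L, ∃ d, 1 ≤ d ∧ f.IsHomogeneous d := by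
  induction L with
  | nil => simp [seqL]
  | cons a L ih =>
    obtain ⟨B, t⟩ := a
    intro f hf
    rcases List.mem_append.1 hf with hf | hf
    · exact seqB_homogeneous B t f hf
    · exact ih f hf

theorem WR_prod [DecidableEq σ] (C : Finset σ) (fs : List (MvPolynomial σ k)) (D : Finset σ) :
    (∀ v ∈ D, v ∉ C ∧ WR (PC k (insert v C)) fs) →
    WR (PC k C ⊔ Ideal.span {∏ v ∈ D, X v}) fs := by
  induction D using Finset.induction_on with
  | empty => intro _; simpa using WR_top fs
  | insert v D hv ih =>
    intro h
    have ih' := ih fun w hw => h w (Finset.mem_insert_of_mem hw)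
    obtain ⟨hvC, hvW⟩ := h v (Finset.mem_insert_self _ _)
    rw [Finset.prod_insert hv]
    refine WR_filt (X v) fs _ _ ?_ ih' ?_
    · intro a
      rw [mem_sup_sp, mem_sup_sp]
      refine exists_congr fun b => ?_
      have : X v * a - b * (X v * ∏ v ∈ D, X v) = X v * (a - b * ∏ v ∈ D, X v) := by ring
      rw [this]
      constructor
      · exact Ideal.mul_mem_left _ _
      · intro h
        exact ((PC_prime C).mem_or_mem h).resolve_left fun h => hvC (X_mem_PC.1 h)
    · have h2 : Ideal.span {X v * ∏ v ∈ D, (X v : MvPolynomial σ k)} ≤ Ideal.span {X v} := by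
        rw [Ideal.span_singleton_le_span_singleton]
        exact dvd_mul_right _ _
      rwa [sup_assoc, sup_eq_right.2 h2, PC_sup]

theorem eB_sub_mem [DecidableEq σ] (B C : Finset σ) (t : ℕ) (h : (B \ C).card = t) :
    eB k B t - ∏ v ∈ B \ C, X v ∈ PC k C := by
  have hmem : B \ C ∈ B.powersetCard t :=
    Finset.mem_powersetCard.2 ⟨Finset.sdiff_subset, h⟩
  rw [eB, ← Finset.add_sum_erase _ _ hmem, add_sub_cancel_left]
  refine Ideal.sum_mem _ fun S hS => ?_
  rw [Finset.mem_erase, Finset.mem_powersetCard] at hS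
  obtain ⟨hne, hsub, hcard⟩ := hS
  have : ∃ v ∈ S, v ∈ C := by
    by_contra hcon
    push Not at hcon
    apply hne
    apply Finset.eq_of_subset_of_card_le
    · intro v hv
      exact Finset.mem_sdiff.2 ⟨hsub hv, hcon v hv⟩
    · omega
  obtain ⟨v, hvS, hvC⟩ := this
  exact Ideal.mem_of_dvd _ (Finset.dvd_prod_of_mem _ hvS) (X_mem_PC.2 hvC)

theorem WR_PC [DecidableEq σ] (N : ℕ) : ∀ (L : List (Finset σ × ℕ)) (C : Finset σ),
    (L.map Prod.snd).sum + L.length = N →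
    L.Pairwise (fun a b => Disjoint a.1 b.1) →
    (∀ a ∈ L, a.2 ≤ (a.1 \ C).card) → WR (PC k C) (seqL k L) := by
  induction N with
  | zero =>
    intro L C hN _ _
    have : L = [] := List.length_eq_zero_iff.1 (by omega)
    subst this
    trivial
  | succ N ih =>
    intro L
    match L with
    | [] => intros; trivial
    | (B, 0) :: L =>
      intro C hN hL hC
      have : WR (PC k C) (seqL k L) := ih L C (by simp at hN; omega) (List.pairwise_cons.1 hL).2
        fun a ha => hC a (List.mem_cons_of_mem _ ha)
      simpa [seqL, seqB] using this
    | (B, t + 1) :: L =>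
      intro C hN hL
      obtain ⟨M, hM⟩ : ∃ M, (B \ C).card = M := ⟨_, rfl⟩
      induction M generalizing C with
      | zero => intro hC; have := hC (B, t + 1) (by simp); simp only at this; omega
      | succ M ihM =>
        intro hC
        have hBC := hC (B, t + 1) (by simp)
        simp only at hBC
        have hother : ∀ v ∈ B \ C, ∀ a ∈ L, a.2 ≤ (a.1 \ insert v C).card := by
          intro v hv a ha
          have h1 := hC a (List.mem_cons_of_mem _ ha)
          have h2 : a.1 \ insert v C = a.1 \ C := by
            ext w
            simp only [Finset.mem_sdiff, Finset.mem_insert, not_or]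
            constructor
            · rintro ⟨h, -, h'⟩; exact ⟨h, h'⟩
            · rintro ⟨h, h'⟩
              refine ⟨h, ?_, h'⟩
              rintro rfl
              exact Finset.disjoint_left.1 ((List.pairwise_cons.1 hL).1 a ha)
                (Finset.mem_sdiff.1 hv).1 h
          rwa [h2]
        have hcard : ∀ v ∈ B \ C, (B \ insert v C).card = M := by
          intro v hv
          have : B \ insert v C = (B \ C).erase v := by
            ext w; simp only [Finset.mem_sdiff, Finset.mem_insert, Finset.mem_erase]; tauto
          rw [this, Finset.card_erase_of_mem hv, hM]; rfl
        rcases Nat.lt_or_ge (t + 1) (M + 1) with hlt | hge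
        · obtain ⟨v, hv⟩ : (B \ C).Nonempty := by
            rw [← Finset.card_pos]; omega
          refine WR_deform v _ _ (PC_homogeneous C) ?_ ?_ ?_
          · intro g hg
            exact ((PC_prime C).mem_or_mem hg).resolve_left fun h =>
              (Finset.mem_sdiff.1 hv).2 (X_mem_PC.1 h)
          · intro f hf
            obtain ⟨d, -, hd⟩ := seqL_homogeneous _ f hf
            exact ⟨d, hd⟩
          · rw [PC_sup]
            refine ihM (insert v C) (hcard v hv) ?_
            intro a ha
            rcases List.mem_cons.1 ha with rfl | ha
            · simp only [hcard v hv]; omega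
            · exact hother v hv a ha
        · have hMt : (B \ C).card = t + 1 := by omega
          have hsub := eB_sub_mem (k := k) B C (t + 1) hMt
          refine ⟨?_, ?_⟩
          · intro g hg
            have h1 : (∏ v ∈ B \ C, X v) * g ∈ PC k C := by
              have := Ideal.sub_mem _ hg (Ideal.mul_mem_left _ g hsub)
              convert this using 1; ring
            refine ((PC_prime C).mem_or_mem h1).resolve_left fun h => ?_
            obtain ⟨v, hv, hv'⟩ := ((PC_prime C).prod_mem_iff).1 h
            exact (Finset.mem_sdiff.1 hv).2 (X_mem_PC.1 hv')
          · have heq : PC k C ⊔ Ideal.span {eB k B (t + 1)} =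
                PC k C ⊔ Ideal.span {∏ v ∈ B \ C, X v} := by
              apply le_antisymm
              · refine sup_le le_sup_left ?_
                rw [Ideal.span_singleton_le_iff_mem, mem_sup_sp]
                exact ⟨1, by simpa using hsub⟩
              · refine sup_le le_sup_left ?_
                rw [Ideal.span_singleton_le_iff_mem, mem_sup_sp]
                refine ⟨1, ?_⟩
                have := (PC k C).neg_mem hsub
                simpa using this
            change WR (PC k C ⊔ Ideal.span {eB k B (t + 1)}) (seqB k B t ++ seqL k L)
            rw [heq]
            refine WR_prod C _ _ fun v hv => ⟨(Finset.mem_sdiff.1 hv).2, ?_⟩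
            refine ih ((B, t) :: L) (insert v C) (by simp at hN ⊢; omega)
              (List.pairwise_cons.2 ⟨(List.pairwise_cons.1 hL).1, (List.pairwise_cons.1 hL).2⟩) ?_
            intro a ha
            rcases List.mem_cons.1 ha with rfl | ha
            · simp only [hcard v hv]; omega
            · exact hother v hv a ha

/-- The squarefree monomial ideal given by an upper set of finsets. -/
noncomputable def SQ (U : Set (Finset σ)) (hU : IsUpperSet U) : Ideal (MvPolynomial σ k) where
  carrier := {f | ∀ u ∈ f.support, u.support ∈ U}
  add_mem' := by
    classical
    intro a b ha hb u hu
    rcases Finset.mem_union.1 (support_add hu) with h | h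
    · exact ha u h
    · exact hb u h
  zero_mem' := by intro u hu; simp at hu
  smul_mem' := by
    classical
    intro c f hf u hu
    rw [smul_eq_mul] at hu
    obtain ⟨a, -, b, hb, rfl⟩ := Finset.mem_add.1 (support_mul c f hu)
    refine hU ?_ (hf b hb)
    intro i hi
    simp only [Finsupp.mem_support_iff, Finsupp.add_apply] at *
    omega

theorem mem_SQ {U : Set (Finset σ)} {hU : IsUpperSet U} {f : MvPolynomial σ k} :
    f ∈ SQ U hU ↔ ∀ u ∈ f.support, u.support ∈ U := Iff.rfl

theorem X_mul_mem_SQ [DecidableEq σ] {U : Set (Finset σ)} {hU : IsUpperSet U}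
    {f : MvPolynomial σ k} {v : σ} :
    X v * f ∈ SQ U hU ↔ ∀ u ∈ f.support, insert v u.support ∈ U := by
  have h1 : ∀ u : σ →₀ ℕ, (Finsupp.single v 1 + u).support = insert v u.support := by
    intro u
    ext i
    by_cases h : v = i
    · simp [h]
    · simp [Ne.symm h]
  rw [mem_SQ, support_X_mul]
  simp only [Finset.mem_map, addLeftEmbedding_apply, forall_exists_index, and_imp,
    forall_apply_eq_imp_iff₂, h1]

theorem prod_mul_mem_SQ [DecidableEq σ] {U : Set (Finset σ)} {hU : IsUpperSet U}
    {f : MvPolynomial σ k} {F : Finset σ} :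
    (∏ v ∈ F, X v) * f ∈ SQ U hU ↔ ∀ u ∈ f.support, F ∪ u.support ∈ U := by
  induction F using Finset.induction_on generalizing U with
  | empty => simp [mem_SQ]
  | insert v F hv ih =>
    have hU' : IsUpperSet {T : Finset σ | insert v T ∈ U} :=
      fun S T hST hS => hU (Finset.insert_subset_insert v hST) hS
    rw [Finset.prod_insert hv, mul_assoc, X_mul_mem_SQ]
    have := ih (U := {T : Finset σ | insert v T ∈ U}) (hU := hU')
    rw [mem_SQ] at this
    simp only [Finset.insert_union]
    exact this

theorem mem_of_monomials {J : Ideal (MvPolynomial σ k)} {f : MvPolynomial σ k}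
    (h : ∀ u ∈ f.support, (monomial u (1 : k)) ∈ J) : f ∈ J := by
  rw [f.as_sum]
  refine Ideal.sum_mem _ fun u hu => ?_
  have := J.mul_mem_left (C (coeff u f)) (h u hu)
  rwa [C_mul_monomial, mul_one] at this

theorem prod_dvd_monomial {F : Finset σ} {u : σ →₀ ℕ} (h : F ⊆ u.support) :
    (∏ v ∈ F, X v) ∣ monomial u (1 : k) := by
  rw [monomial_eq, C_1, one_mul, Finsupp.prod]
  refine (Finset.prod_dvd_prod_of_dvd _ _ fun v hv => ?_).trans (Finset.prod_dvd_prod_of_subset _ _ _ h)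
  exact dvd_pow_self _ (Finsupp.mem_support_iff.1 (h hv))

theorem SQ_sup {U V : Set (Finset σ)} {hU : IsUpperSet U} {hV : IsUpperSet V}
    {v : σ} (h : ∀ T, T ∈ V ↔ T ∈ U ∨ v ∈ T) :
    (SQ U hU ⊔ Ideal.span {X v} : Ideal (MvPolynomial σ k)) = SQ V hV := by
  classical
  apply le_antisymm
  · refine sup_le (fun f hf u hu => (h _).2 (Or.inl (hf u hu))) ?_
    rw [Ideal.span_singleton_le_iff_mem, ← mul_one (X v), X_mul_mem_SQ]
    intro u _
    exact (h _).2 (Or.inr (Finset.mem_insert_self _ _))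
  · intro f hf
    refine mem_of_monomials fun u hu => ?_
    rcases (h _).1 (hf u hu) with h1 | h1
    · refine Ideal.mem_sup_left ?_
      intro w hw
      have := support_monomial_subset hw
      rw [Finset.mem_singleton] at this
      rwa [this]
    · refine Ideal.mem_sup_right (Ideal.mem_span_singleton.2 ?_)
      have := prod_dvd_monomial (k := k) (Finset.singleton_subset_iff.2 h1)
      simpa using this

theorem SQ_eq_PC {U : Set (Finset σ)} {hU : IsUpperSet U} {C : Finset σ}
    (h : ∀ T, T ∈ U ↔ ∃ c ∈ C, c ∈ T) : (SQ U hU : Ideal (MvPolynomial σ k)) = PC k C := by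
  ext f
  rw [mem_SQ, mem_PC]
  simp only [h, Finsupp.mem_support_iff]

end Poly

section Comb
open MvPolynomial
variable {k : Type*} [Field k] {n : ℕ}

theorem SQ_congr {σ : Type*} {U V : Set (Finset σ)} {hU : IsUpperSet U} {hV : IsUpperSet V}
    (h : ∀ T, T ∈ U ↔ T ∈ V) : (SQ U hU : Ideal (MvPolynomial σ k)) = SQ V hV := by
  ext f; rw [mem_SQ, mem_SQ]; simp only [h]

/-- Non-faces in the intermediate stages of the decomposition. -/
def UU (ℓ : ℕ) (C : Finset (Fin n)) (a : ℕ) (free : ℕ → Prop) : Set (Finset (Fin n)) :=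
  {T | (∃ c ∈ C, c ∈ T) ∨ ∃ i, a ≤ i ∧ i + ℓ < n ∧
    ∀ v : Fin n, i ≤ (v : ℕ) → (v : ℕ) ≤ i + ℓ → ¬ free v → v ∈ T}

theorem mem_UU {ℓ : ℕ} {C : Finset (Fin n)} {a : ℕ} {free : ℕ → Prop} {T : Finset (Fin n)} :
    T ∈ UU ℓ C a free ↔ (∃ c ∈ C, c ∈ T) ∨ ∃ i, a ≤ i ∧ i + ℓ < n ∧
    ∀ v : Fin n, i ≤ (v : ℕ) → (v : ℕ) ≤ i + ℓ → ¬ free v → v ∈ T := Iff.rfl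

theorem UU_upper (ℓ : ℕ) (C : Finset (Fin n)) (a : ℕ) (free : ℕ → Prop) :
    IsUpperSet (UU ℓ C a free) := by
  intro S T hST hS
  rcases hS with ⟨c, hc, h⟩ | ⟨i, h1, h2, h3⟩
  · exact Or.inl ⟨c, hc, hST h⟩
  · exact Or.inr ⟨i, h1, h2, fun v a b c => hST (h3 v a b c)⟩

/-- Conditions satisfied by the vertex covers in the decomposition. -/
structure FinC (ℓ : ℕ) (C : Finset (Fin n)) : Prop where
  three : ∀ x ∈ C, ∀ y ∈ C, ∀ z ∈ C, x < y → y < z → (x : ℕ) + ℓ + 2 ≤ z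
  left : ∀ x ∈ C, ∀ y ∈ C, x < y → ℓ + 1 ≤ (y : ℕ)
  right : ∀ x ∈ C, ∀ y ∈ C, x < y → (x : ℕ) + ℓ + 2 ≤ n
  one : ∀ x ∈ C, ℓ + 1 ≤ n

structure CoverInv (ℓ : ℕ) (C : Finset (Fin n)) (a p : ℕ) : Prop extends FinC ℓ C where
  ap : a ≤ p
  pa : p ≤ a + ℓ + 1
  lt : ∀ c ∈ C, (c : ℕ) < a
  prev : ∀ c ∈ C, (c : ℕ) + 1 ≠ a → (c : ℕ) + ℓ + 2 ≤ p
  ne : ∀ c ∈ C, ℓ + 1 ≤ p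

theorem WR_rec (ℓ : ℕ) (fs : List (MvPolynomial (Fin n) k))
    (hleaf : ∀ C, FinC ℓ C → WR (PC k C) fs) (d : ℕ) :
    ∀ (C : Finset (Fin n)) (a p : ℕ), n ≤ a + d → CoverInv ℓ C a p →
      WR (SQ (UU ℓ C a (fun v => v < p)) (UU_upper _ _ _ _)) fs := by
  induction d with
  | zero =>
    intro C a p hd hI
    rw [SQ_eq_PC (C := C)]
    · exact hleaf C hI.toFinC
    · intro T
      rw [mem_UU]
      constructor
      · rintro (h | ⟨i, h1, h2, -⟩)
        · exact h
        · omega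
      · exact Or.inl
  | succ d ih =>
    intro C a p hd hI
    by_cases hs : n < a + ℓ + 1
    · rw [SQ_eq_PC (C := C)]
      · exact hleaf C hI.toFinC
      · intro T
        rw [mem_UU]
        constructor
        · rintro (h | ⟨i, h1, h2, -⟩)
          · exact h
          · omega
        · exact Or.inl
    · push Not at hs
      have hap := hI.ap
      have hpa := hI.pa
      have key : ∀ j, p ≤ j → j ≤ a + ℓ + 1 →
          WR (SQ (UU ℓ C a (fun v => v < p ∨ (j ≤ v ∧ v < a + ℓ + 1))) (UU_upper _ _ _ _)) fs := by
        intro j hj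
        induction j, hj using Nat.le_induction with
        | base =>
          intro _
          rw [show SQ (UU ℓ C a (fun v => v < p ∨ (p ≤ v ∧ v < a + ℓ + 1))) (UU_upper _ _ _ _) =
            (⊤ : Ideal (MvPolynomial (Fin n) k)) from ?_]
          · exact WR_top fs
          · rw [eq_top_iff]
            intro f _ u _
            refine Or.inr ⟨a, le_rfl, by omega, fun v h1 h2 h3 => ?_⟩
            exfalso; omega
        | succ j hj ihj =>
          intro hjs
          have ihj' := ihj (by omega)
          have hjn : j < n := by omega
          refine WR_filt (X ⟨j, hjn⟩) fs _ _ ?_ ihj' ?_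
          · intro f
            rw [X_mul_mem_SQ, mem_SQ]
            refine forall₂_congr fun u _ => ?_
            rw [mem_UU, mem_UU]
            refine or_congr ?_ ?_
            · refine exists_congr fun c => and_congr_right fun hc => ?_
              rw [Finset.mem_insert]
              have hca := hI.lt c hc
              have : c ≠ ⟨j, hjn⟩ := by
                rintro rfl
                simp only at hca
                omega
              simp [this]
            · refine exists_congr fun i => and_congr_right fun _ => and_congr_right fun _ => ?_
              refine forall_congr' fun v => forall₂_congr fun _ _ => ?_
              rw [Finset.mem_insert, Fin.ext_iff]
              constructor
              · intro h h1
                by_cases hv : (v : ℕ) = j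
                · exact Or.inl hv
                · exact Or.inr (h (by omega))
              · intro h h1
                rcases h (by omega) with h2 | h2
                · have h3 : (v : ℕ) = j := h2
                  omega
                · exact h2
          · rw [SQ_sup (V := UU ℓ (insert ⟨j, hjn⟩ C) (j + 1) (fun v => v < a + ℓ + 1))
              (hV := UU_upper _ _ _ _)]
            · refine ih _ _ _ (by omega) ?_
              have hnew : ∀ c ∈ insert (⟨j, hjn⟩ : Fin n) C, c = ⟨j, hjn⟩ ∨ c ∈ C :=
                fun c hc => Finset.mem_insert.1 hc
              refine ⟨⟨?_, ?_, ?_, ?_⟩, by omega, by omega, ?_, ?_, ?_⟩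
              · intro x hx y hy z hz hxy hyz
                rw [Fin.lt_def] at hxy hyz
                rcases hnew x hx with rfl | hx
                · exfalso
                  rcases hnew y hy with rfl | hy
                  · omega
                  · have := hI.lt y hy
                    simp only at *
                    omega
                rcases hnew y hy with rfl | hy
                · exfalso
                  rcases hnew z hz with rfl | hz
                  · omega
                  · have := hI.lt z hz
                    simp only at *
                    omega
                rcases hnew z hz with rfl | hz
                · have h1 := hI.lt y hy
                  have h2 := hI.prev x hx (by omega)
                  simp only
                  omega
                · exact hI.three x hx y hy z hz hxy hyz
              · intro x hx y hy hxy
                rw [Fin.lt_def] at hxy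
                rcases hnew x hx with rfl | hx
                · exfalso
                  rcases hnew y hy with rfl | hy
                  · omega
                  · have := hI.lt y hy
                    simp only at *
                    omega
                rcases hnew y hy with rfl | hy
                · have := hI.ne x hx
                  simp only
                  omega
                · exact hI.left x hx y hy hxy
              · intro x hx y hy hxy
                rw [Fin.lt_def] at hxy
                rcases hnew x hx with rfl | hx
                · exfalso
                  rcases hnew y hy with rfl | hy
                  · omega
                  · have := hI.lt y hy
                    simp only at *
                    omega
                have := hI.lt x hx
                omega
              · intro x _
                omega
              · intro c hc
                rcases hnew c hc with rfl | hc
                · simp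
                · have := hI.lt c hc
                  omega
              · intro c hc hne
                rcases hnew c hc with rfl | hc
                · simp at hne
                · have := hI.lt c hc
                  omega
              · intro c _
                omega
            · intro T
              rw [mem_UU, mem_UU]
              constructor
              · rintro (⟨c, hc, hcT⟩ | ⟨i, h1, h2, h3⟩)
                · rcases Finset.mem_insert.1 hc with rfl | hc
                  · exact Or.inr hcT
                  · exact Or.inl (Or.inl ⟨c, hc, hcT⟩)
                · refine Or.inl (Or.inr ⟨i, by omega, h2, fun v a b c => h3 v a b ?_⟩)
                  omega
              · rintro ((⟨c, hc, hcT⟩ | ⟨i, h1, h2, h3⟩) | h)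
                · exact Or.inl ⟨c, Finset.mem_insert_of_mem hc, hcT⟩
                · by_cases hij : i ≤ j
                  · exact Or.inl ⟨_, Finset.mem_insert_self _ _,
                      h3 ⟨j, hjn⟩ hij (by simp only; omega) (by simp only; omega)⟩
                  · refine Or.inr ⟨i, by omega, h2, fun v a b c => h3 v a b ?_⟩
                    omega
                · exact Or.inl ⟨_, Finset.mem_insert_self _ _, h⟩
      have h := key (a + ℓ + 1) hpa le_rfl
      rwa [SQ_congr (V := UU ℓ C a (fun v => v < p)) (hV := UU_upper _ _ _ _)] at h
      intro T
      rw [mem_UU, mem_UU]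
      refine or_congr Iff.rfl (exists_congr fun i => and_congr_right fun _ =>
        and_congr_right fun _ => forall_congr' fun v => forall₂_congr fun _ _ => ?_)
      have : (¬((v : ℕ) < p ∨ a + ℓ + 1 ≤ (v : ℕ) ∧ (v : ℕ) < a + ℓ + 1)) ↔ ¬ (v : ℕ) < p := by
        omega
      rw [this]

theorem spine_eq (k : Type*) [Field k] (n ℓ : ℕ) :
    spinePathIdeal k n ℓ = SQ (UU ℓ ∅ 0 (fun v => v < 0)) (UU_upper _ _ _ _) := by
  apply le_antisymm
  · rw [spinePathIdeal, Ideal.span_le]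
    rintro _ ⟨i, hi, rfl⟩
    beta_reduce
    rw [SetLike.mem_coe, ← mul_one (∏ v ∈ _, _), prod_mul_mem_SQ]
    intro u _
    refine Or.inr ⟨i, by omega, hi, fun v h1 h2 _ => ?_⟩
    exact Finset.mem_union_left _ (by simp [h1, h2])
  · intro f hf
    refine mem_of_monomials fun u hu => ?_
    rcases hf u hu with ⟨c, hc, -⟩ | ⟨i, -, h1, h2⟩
    · simp at hc
    · refine Ideal.mem_of_dvd _ (prod_dvd_monomial ?_) (Ideal.subset_span ⟨i, h1, rfl⟩)
      intro v hv
      simp only [Finset.mem_filter] at hv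
      exact h2 v hv.2.1 hv.2.2 (by omega)

/-- Intervals in `Fin n`. -/
def IB (n lo hi : ℕ) : Finset (Fin n) :=
  Finset.univ.filter (fun v : Fin n => lo ≤ (v : ℕ) ∧ (v : ℕ) < hi)

theorem mem_IB {lo hi : ℕ} {v : Fin n} : v ∈ IB n lo hi ↔ lo ≤ (v : ℕ) ∧ (v : ℕ) < hi := by
  simp [IB]

theorem card_IB {lo hi : ℕ} (h : hi ≤ n) : (IB n lo hi).card = hi - lo := by
  rw [← Nat.card_Ico, ← Finset.card_map Fin.valEmbedding]
  congr 1
  ext w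
  simp only [Finset.mem_map, mem_IB, Fin.valEmbedding_apply, Finset.mem_Ico]
  constructor
  · rintro ⟨v, hv, rfl⟩; exact hv
  · intro hw
    exact ⟨⟨w, by omega⟩, hw, rfl⟩

/-- The blocks. -/
def blocks (n ℓ : ℕ) : List (Finset (Fin n) × ℕ) :=
  (List.range (n / (ℓ + 2) + 1)).map fun j =>
    (IB n (j * (ℓ + 2) - 1) (min n ((j + 1) * (ℓ + 2) - 1)),
      if j < n / (ℓ + 2) then ℓ else min (n % (ℓ + 2)) ℓ)

theorem blocks_sum (n ℓ : ℕ) : ((blocks n ℓ).map Prod.snd).sum =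
    (n / (ℓ + 2)) * ℓ + min (n % (ℓ + 2)) ℓ := by
  rw [blocks, List.map_map, List.range_succ, List.map_append, List.sum_append]
  have : (List.range (n / (ℓ + 2))).map (Prod.snd ∘ fun j =>
      (IB n (j * (ℓ + 2) - 1) (min n ((j + 1) * (ℓ + 2) - 1)),
      if j < n / (ℓ + 2) then ℓ else min (n % (ℓ + 2)) ℓ)) =
      (List.range (n / (ℓ + 2))).map (fun _ => ℓ) := by
    apply List.map_congr_left
    intro j hj
    simp [List.mem_range.1 hj]
  rw [this]
  simp

theorem blocks_pairwise (n ℓ : ℕ) :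
    (blocks n ℓ).Pairwise (fun a b => Disjoint a.1 b.1) := by
  rw [blocks, List.pairwise_map]
  refine List.Pairwise.imp ?_ List.pairwise_lt_range
  intro i j hij
  rw [Finset.disjoint_left]
  intro v hv hv'
  rw [mem_IB] at hv hv'
  have : (i + 1) * (ℓ + 2) ≤ j * (ℓ + 2) := Nat.mul_le_mul_right _ hij
  omega

theorem exists_two {S : Finset (Fin n)} (h : 1 < S.card) : ∃ x ∈ S, ∃ y ∈ S, x < y :=
  ⟨S.orderEmbOfFin rfl ⟨0, by omega⟩, S.orderEmbOfFin_mem rfl _,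
    S.orderEmbOfFin rfl ⟨1, by omega⟩, S.orderEmbOfFin_mem rfl _, by simp⟩

theorem exists_three {S : Finset (Fin n)} (h : 2 < S.card) :
    ∃ x ∈ S, ∃ y ∈ S, ∃ z ∈ S, x < y ∧ y < z :=
  ⟨S.orderEmbOfFin rfl ⟨0, by omega⟩, S.orderEmbOfFin_mem rfl _,
    S.orderEmbOfFin rfl ⟨1, by omega⟩, S.orderEmbOfFin_mem rfl _,
    S.orderEmbOfFin rfl ⟨2, by omega⟩, S.orderEmbOfFin_mem rfl _, by simp, by simp⟩

theorem blocks_card (n ℓ : ℕ) (C : Finset (Fin n)) (hC : FinC ℓ C) :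
    ∀ a ∈ blocks n ℓ, a.2 ≤ (a.1 \ C).card := by
  intro a ha
  obtain ⟨j, hj, rfl⟩ := List.mem_map.1 ha
  rw [List.mem_range] at hj
  simp only
  set lo := j * (ℓ + 2) - 1 with hlo
  set hi := min n ((j + 1) * (ℓ + 2) - 1) with hhi
  have hcard := card_IB (n := n) (lo := lo) (hi := hi) (min_le_left _ _)
  have hsd : (IB n lo hi \ C).card + (IB n lo hi ∩ C).card = (IB n lo hi).card :=
    Finset.card_sdiff_add_card_inter _ _
  have hdm := Nat.div_add_mod n (ℓ + 2)
  have hml := Nat.mod_lt n (show 0 < ℓ + 2 by omega)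
  have hsm : (j + 1) * (ℓ + 2) = j * (ℓ + 2) + (ℓ + 2) := Nat.succ_mul _ _
  have h2 : (IB n lo hi ∩ C).card ≤ 2 := by
    by_contra hcon
    obtain ⟨x, hx, y, hy, z, hz, hxy, hyz⟩ := exists_three (not_le.1 hcon)
    rw [Finset.mem_inter, mem_IB] at hx hy hz
    have := hC.three x hx.2 y hy.2 z hz.2 hxy hyz
    omega
  have h1l : hi ≤ ℓ + 1 → (IB n lo hi ∩ C).card ≤ 1 := by
    intro hh
    by_contra hcon
    obtain ⟨x, hx, y, hy, hxy⟩ := exists_two (not_le.1 hcon)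
    rw [Finset.mem_inter, mem_IB] at hx hy
    have := hC.left x hx.2 y hy.2 hxy
    omega
  have h1r : n ≤ lo + ℓ + 1 → (IB n lo hi ∩ C).card ≤ 1 := by
    intro hh
    by_contra hcon
    obtain ⟨x, hx, y, hy, hxy⟩ := exists_two (not_le.1 hcon)
    rw [Finset.mem_inter, mem_IB] at hx hy
    have := hC.right x hx.2 y hy.2 hxy
    omega
  have h0 : n ≤ ℓ → (IB n lo hi ∩ C).card = 0 := by
    intro hh
    rw [Finset.card_eq_zero, Finset.eq_empty_iff_forall_notMem]
    intro x hx
    have := hC.one x (Finset.mem_inter.1 hx).2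
    omega
  have hj0 : 1 ≤ j → ℓ + 2 ≤ j * (ℓ + 2) := fun h => Nat.le_mul_of_pos_left _ h
  split_ifs with hjJ
  · have : (j + 1) * (ℓ + 2) ≤ (n / (ℓ + 2)) * (ℓ + 2) := Nat.mul_le_mul_right _ hjJ
    rw [mul_comm (ℓ + 2)] at hdm
    rcases Nat.eq_zero_or_pos j with rfl | hjp
    · simp only [zero_mul] at *
      omega
    · have := hj0 hjp
      omega
  · have hjeq : j = n / (ℓ + 2) := by omega
    rw [mul_comm (ℓ + 2), ← hjeq] at hdm
    rcases Nat.eq_zero_or_pos j with hj00 | hjp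
    · rw [hj00] at hdm hsm hlo hhi
      simp only [zero_mul] at *
      omega
    · have := hj0 hjp
      omega

theorem ceil_sum (n ℓ : ℕ) : ∑ i ∈ Finset.range ℓ, (n - i + ℓ + 1) / (ℓ + 2) =
    (n / (ℓ + 2)) * ℓ + min (n % (ℓ + 2)) ℓ := by
  have hdm := Nat.div_add_mod n (ℓ + 2)
  have hml := Nat.mod_lt n (show 0 < ℓ + 2 by omega)
  rw [mul_comm] at hdm
  set J := n / (ℓ + 2)
  set ρ := n % (ℓ + 2)
  have hterm : ∀ i ∈ Finset.range ℓ, (n - i + ℓ + 1) / (ℓ + 2) = J + if i < ρ then 1 else 0 := by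
    intro i hi
    rw [Finset.mem_range] at hi
    have h0 : J = 0 ∨ ℓ + 2 ≤ J * (ℓ + 2) := by
      rcases Nat.eq_zero_or_pos J with h | h
      · exact Or.inl h
      · exact Or.inr (Nat.le_mul_of_pos_left _ h)
    have e1 : (J + 1) * (ℓ + 2) = J * (ℓ + 2) + (ℓ + 2) := Nat.succ_mul _ _
    have e2 : (J + 1 + 1) * (ℓ + 2) = J * (ℓ + 2) + (ℓ + 2) + (ℓ + 2) := by
      rw [Nat.succ_mul, e1]
    split_ifs with h
    · apply Nat.div_eq_of_lt_le <;> omega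
    · rw [add_zero]
      rcases h0 with h0 | h0
      · have : J * (ℓ + 2) = 0 := by rw [h0, zero_mul]
        apply Nat.div_eq_of_lt_le <;> omega
      · apply Nat.div_eq_of_lt_le <;> omega
  rw [Finset.sum_congr rfl hterm, Finset.sum_add_distrib, Finset.sum_const, Finset.card_range,
    smul_eq_mul, mul_comm, Finset.sum_boole]
  congr 1
  have : (Finset.range ℓ).filter (fun i => i < ρ) = Finset.range (min ρ ℓ) := by
    ext i; simp only [Finset.mem_filter, Finset.mem_range]; omega
  rw [this]; simp

/-- The minimal vertex cover of maximal size. -/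
def CC (n ℓ : ℕ) : Finset (Fin n) :=
  Finset.univ.filter (fun v : Fin n => (v : ℕ) % (ℓ + 2) = min (n % (ℓ + 2)) ℓ ∨
    (v : ℕ) % (ℓ + 2) = ℓ + 1)

theorem mem_CC {ℓ : ℕ} {v : Fin n} : v ∈ CC n ℓ ↔
    (v : ℕ) % (ℓ + 2) = min (n % (ℓ + 2)) ℓ ∨ (v : ℕ) % (ℓ + 2) = ℓ + 1 := by
  simp [CC]

theorem card_compl_CC (n ℓ : ℕ) :
    ((CC n ℓ)ᶜ).card ≤ (n / (ℓ + 2)) * ℓ + min (n % (ℓ + 2)) ℓ := by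
  have hdm := Nat.div_add_mod n (ℓ + 2)
  have hml := Nat.mod_lt n (show 0 < ℓ + 2 by omega)
  set r := min (n % (ℓ + 2)) ℓ with hr
  set idx : ℕ → ℕ := fun i => if i < r then i else i - 1 with hidx
  have hidxlt : ∀ v ∈ (CC n ℓ)ᶜ, idx ((v : ℕ) % (ℓ + 2)) < ℓ := by
    intro v hv
    rw [Finset.mem_compl, mem_CC] at hv
    have := Nat.mod_lt (v : ℕ) (show 0 < ℓ + 2 by omega)
    simp only [hidx]
    split_ifs <;> omega
  rw [← Finset.card_range ((n / (ℓ + 2)) * ℓ + r)]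
  refine Finset.card_le_card_of_injOn
    (fun v => ((v : ℕ) / (ℓ + 2)) * ℓ + idx ((v : ℕ) % (ℓ + 2))) ?_ ?_
  · intro v hv
    have h1 := hidxlt v hv
    have hvd := Nat.div_add_mod (v : ℕ) (ℓ + 2)
    have hvm := Nat.mod_lt (v : ℕ) (show 0 < ℓ + 2 by omega)
    have hle : (v : ℕ) / (ℓ + 2) ≤ n / (ℓ + 2) := Nat.div_le_div_right v.2.le
    simp only [Finset.coe_range, Set.mem_Iio]
    rcases Nat.lt_or_ge ((v : ℕ) / (ℓ + 2)) (n / (ℓ + 2)) with h | h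
    · have : ((v : ℕ) / (ℓ + 2) + 1) * ℓ ≤ (n / (ℓ + 2)) * ℓ := Nat.mul_le_mul_right _ h
      rw [Nat.succ_mul] at this
      omega
    · have heq : (v : ℕ) / (ℓ + 2) = n / (ℓ + 2) := le_antisymm hle h
      rw [heq] at hvd ⊢
      have hv2 := v.2
      have hv' := hv
      rw [Finset.mem_coe, Finset.mem_compl, mem_CC] at hv'
      have : (v : ℕ) % (ℓ + 2) < r := by omega
      simp only [hidx, if_pos this]
      omega
  · intro v hv w hw hvw
    have h1 := hidxlt v hv
    have h2 := hidxlt w hw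
    simp only at hvw
    have hpos : 0 < ℓ := by omega
    have hd : (v : ℕ) / (ℓ + 2) = (w : ℕ) / (ℓ + 2) := by
      have := congrArg (· / ℓ) hvw
      simp only [mul_comm _ ℓ, Nat.mul_add_div hpos, Nat.div_eq_of_lt h1, Nat.div_eq_of_lt h2] at this
      simpa using this
    have hi : idx ((v : ℕ) % (ℓ + 2)) = idx ((w : ℕ) % (ℓ + 2)) := by
      rw [hd] at hvw; omega
    have hv' := hv
    have hw' := hw
    rw [Finset.mem_coe, Finset.mem_compl, mem_CC] at hv' hw'
    have hm : (v : ℕ) % (ℓ + 2) = (w : ℕ) % (ℓ + 2) := by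
      simp only [hidx] at hi
      split_ifs at hi <;> omega
    apply Fin.ext
    rw [← Nat.div_add_mod (v : ℕ) (ℓ + 2), ← Nat.div_add_mod (w : ℕ) (ℓ + 2), hd, hm]

theorem CC_colon (n ℓ : ℕ) (T : Finset (Fin n)) :
    (CC n ℓ)ᶜ ∪ T ∈ UU ℓ ∅ 0 (fun v => v < 0) ↔ ∃ c ∈ CC n ℓ, c ∈ T := by
  have hdm := Nat.div_add_mod n (ℓ + 2)
  have hml := Nat.mod_lt n (show 0 < ℓ + 2 by omega)
  rw [mem_UU]
  constructor
  · rintro (⟨c, hc, -⟩ | ⟨i, -, hi, h⟩)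
    · simp at hc
    · have hid := Nat.div_add_mod i (ℓ + 2)
      have him := Nat.mod_lt i (show 0 < ℓ + 2 by omega)
      -- an element of the cover in the interval
      obtain ⟨v, h1, h2, hv⟩ : ∃ v : Fin n, i ≤ (v : ℕ) ∧ (v : ℕ) ≤ i + ℓ ∧ v ∈ CC n ℓ := by
        by_cases h0 : i % (ℓ + 2) = 0
        · refine ⟨⟨i + min (n % (ℓ + 2)) ℓ, by omega⟩, by simp, by simp, ?_⟩
          rw [mem_CC]
          left
          simp only
          rw [Nat.add_mod, h0, zero_add, Nat.mod_mod, Nat.mod_eq_of_lt (by omega)]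
        · refine ⟨⟨i + (ℓ + 1 - i % (ℓ + 2)), by omega⟩, by simp, by simp only; omega, ?_⟩
          rw [mem_CC]
          right
          simp only
          have : i + (ℓ + 1 - i % (ℓ + 2)) = ℓ + 1 + (ℓ + 2) * (i / (ℓ + 2)) := by omega
          rw [this, Nat.add_mul_mod_self_left, Nat.mod_eq_of_lt (by omega)]
      refine ⟨v, hv, ?_⟩
      rcases Finset.mem_union.1 (h v h1 h2 (by omega)) with h3 | h3
      · exact absurd hv (Finset.mem_compl.1 h3)
      · exact h3
  · rintro ⟨c, hc, hcT⟩
    right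
    have hcd := Nat.div_add_mod (c : ℕ) (ℓ + 2)
    have hcm := Nat.mod_lt (c : ℕ) (show 0 < ℓ + 2 by omega)
    have hcn := c.2
    have hle : (c : ℕ) / (ℓ + 2) ≤ n / (ℓ + 2) := Nat.div_le_div_right c.2.le
    have hle' : (c : ℕ) / (ℓ + 2) < n / (ℓ + 2) →
        (ℓ + 2) * ((c : ℕ) / (ℓ + 2)) + (ℓ + 2) ≤ (ℓ + 2) * (n / (ℓ + 2)) := by
      intro h
      have : (ℓ + 2) * ((c : ℕ) / (ℓ + 2) + 1) ≤ (ℓ + 2) * (n / (ℓ + 2)) :=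
        Nat.mul_le_mul_left _ h
      rwa [Nat.mul_succ] at this
    have hcases : (c : ℕ) / (ℓ + 2) < n / (ℓ + 2) ∨
        (ℓ + 2) * ((c : ℕ) / (ℓ + 2)) = (ℓ + 2) * (n / (ℓ + 2)) := by
      rcases hle.lt_or_eq with h | h
      · exact Or.inl h
      · exact Or.inr (by rw [h])
    set q := (ℓ + 2) * ((c : ℕ) / (ℓ + 2)) with hq
    -- residue of elements in the block after `q`
    have hres : ∀ v : ℕ, q ≤ v → v < q + (ℓ + 2) → v % (ℓ + 2) = v - q := by
      intro v h1 h2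
      have : v = (v - q) + (ℓ + 2) * ((c : ℕ) / (ℓ + 2)) := by omega
      conv_lhs => rw [this]
      rw [Nat.add_mul_mod_self_left, Nat.mod_eq_of_lt (by omega)]
    have hres' : ∀ v : ℕ, q + (ℓ + 2) ≤ v → v < q + (ℓ + 2) + (ℓ + 2) →
        v % (ℓ + 2) = v - q - (ℓ + 2) := by
      intro v h1 h2
      have : v = (v - q - (ℓ + 2)) + (ℓ + 2) * ((c : ℕ) / (ℓ + 2) + 1) := by
        rw [Nat.mul_succ]; omega
      conv_lhs => rw [this]
      rw [Nat.add_mul_mod_self_left, Nat.mod_eq_of_lt (by omega)]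
    rcases mem_CC.1 hc with hcr | hcr
    · refine ⟨q, by omega, ?_, ?_⟩
      · rcases hcases with h | h
        · have := hle' h; omega
        · omega
      · intro v h1 h2 _
        by_cases hvc : v = c
        · rw [hvc]; exact Finset.mem_union_right _ hcT
        · refine Finset.mem_union_left _ ?_
          rw [Finset.mem_compl, mem_CC, hres v h1 (by omega)]
          have : (v : ℕ) ≠ c := fun h => hvc (Fin.ext h)
          omega
    · have hlt : (c : ℕ) / (ℓ + 2) < n / (ℓ + 2) := by
        rcases hcases with h | h
        · exact h
        · omega
      have hle2 := hle' hlt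
      refine ⟨q + min (n % (ℓ + 2)) ℓ + 1, by omega, by omega, ?_⟩
      intro v h1 h2 _
      by_cases hvc : v = c
      · rw [hvc]; exact Finset.mem_union_right _ hcT
      · refine Finset.mem_union_left _ ?_
        have : (v : ℕ) ≠ c := fun h => hvc (Fin.ext h)
        rw [Finset.mem_compl, mem_CC]
        rcases Nat.lt_or_ge (v : ℕ) (q + (ℓ + 2)) with h3 | h3
        · rw [hres v (by omega) h3]; omega
        · rw [hres' v h3 (by omega)]; omega

theorem height_PC (C : Finset (Fin n)) :
    (C.card : ℕ∞) ≤ Order.height (⟨PC k C, PC_prime C⟩ : PrimeSpectrum (MvPolynomial (Fin n) k)) := by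
  induction C using Finset.induction_on with
  | empty => simp
  | insert v C hv ih =>
    rw [Finset.card_insert_of_notMem hv]
    have hlt : (⟨PC k C, PC_prime C⟩ : PrimeSpectrum (MvPolynomial (Fin n) k)) <
        ⟨PC k (insert v C), PC_prime _⟩ := by
      refine lt_of_le_of_ne ?_ ?_
      · change PC k C ≤ PC k (insert v C)
        rw [← PC_sup]; exact le_sup_left
      · intro h
        have h' : PC k C = PC k (insert v C) := congrArg PrimeSpectrum.asIdeal h
        have : (X v : MvPolynomial (Fin n) k) ∈ PC k (insert v C) :=
          X_mem_PC.2 (Finset.mem_insert_self _ _)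
        rw [← h'] at this
        exact hv (X_mem_PC.1 this)
    push_cast
    exact (add_le_add_left ih 1).trans (Order.height_add_one_le hlt)

theorem coheight_PC (C : Finset (Fin n)) :
    Order.coheight (⟨PC k C, PC_prime C⟩ : PrimeSpectrum (MvPolynomial (Fin n) k)) ≤ (Cᶜ.card : ℕ∞) := by
  set p : PrimeSpectrum (MvPolynomial (Fin n) k) := ⟨PC k C, PC_prime C⟩ with hp
  have h1 : ((Order.height p + Order.coheight p : ℕ∞) : WithBot ℕ∞) ≤
      Order.krullDim (PrimeSpectrum (MvPolynomial (Fin n) k)) := by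
    rw [Order.krullDim_eq_iSup_height_add_coheight_of_nonempty]
    exact WithBot.coe_le_coe.2 (le_iSup (fun a => Order.height a + Order.coheight a) p)
  have h2 : Order.krullDim (PrimeSpectrum (MvPolynomial (Fin n) k)) = ((n : ℕ∞) : WithBot ℕ∞) := by
    have := MvPolynomial.ringKrullDim_of_isNoetherianRing (R := k) (ι := Fin n)
    rw [ringKrullDim_eq_zero_of_field, zero_add, Nat.card_fin] at this
    exact this
  rw [h2, WithBot.coe_le_coe] at h1
  have h3 := height_PC (k := k) C
  have h4 : (C.card : ℕ∞) + Order.coheight p ≤ n := (add_le_add_left h3 _).trans h1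
  have h5 : C.card + Cᶜ.card = n := by
    rw [Finset.card_add_card_compl, Fintype.card_fin]
  have h6 : (n : ℕ∞) = (C.card : ℕ∞) + Cᶜ.card := by exact_mod_cast h5.symm
  rw [h6] at h4
  exact (ENat.add_le_add_iff_left (ENat.natCast_ne_top _)).1 h4

theorem mem_PC_univ_of_homogeneous {f : MvPolynomial (Fin n) k} {d : ℕ} (hd : 1 ≤ d)
    (hf : f.IsHomogeneous d) : f ∈ PC k (Finset.univ : Finset (Fin n)) := by
  rw [mem_PC]
  intro u hu
  by_contra hcon
  push Not at hcon
  have h0 : u = 0 := by ext i; exact hcon i (Finset.mem_univ i)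
  have := hf (mem_support_iff.1 hu)
  rw [h0] at this
  simp at this
  omega

end Comb

theorem depth_spinePathIdeal_ceil_sum (k : Type*) [Field k] (n ℓ : ℕ)
    (hℓ : 1 ≤ ℓ) :
    quotientDepth k (spinePathIdeal k n ℓ) =
      ∑ i ∈ Finset.range ℓ, (n - i + ℓ + 1) / (ℓ + 2) := by
  rw [ceil_sum, quotientDepth]
  have hm : Ideal.span (Set.range (MvPolynomial.X : Fin n → MvPolynomial (Fin n) k)) =
      PC k Finset.univ := by
    rw [PC, Finset.coe_univ, Set.image_univ]
  rw [hm, spine_eq]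
  have hmp : (PC k (Finset.univ : Finset (Fin n))).IsPrime := PC_prime _
  apply IsGreatest.csSup_eq
  constructor
  · have hseq : ∀ r ∈ seqL k (blocks n ℓ), r ∈ PC k (Finset.univ : Finset (Fin n)) := by
      intro r hr
      obtain ⟨d, hd, hh⟩ := seqL_homogeneous _ r hr
      exact mem_PC_univ_of_homogeneous hd hh
    refine ⟨seqL k (blocks n ℓ), ?_, hseq, ?_, ?_⟩
    · rw [length_seqL, blocks_sum]
    · rw [isWeaklyRegular_iff_WR]
      refine WR_rec ℓ _ ?_ n ∅ 0 0 (by omega) ?_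
      · intro C hC
        exact WR_PC _ _ _ rfl (blocks_pairwise n ℓ) (blocks_card n ℓ C hC)
      · refine ⟨⟨?_, ?_, ?_, ?_⟩, by omega, by omega, ?_, ?_, ?_⟩ <;> simp
    · intro htop
      have hle : (Ideal.ofList (seqL k (blocks n ℓ)) • ⊤ : Submodule (MvPolynomial (Fin n) k)
          (MvPolynomial (Fin n) k ⧸ SQ (UU ℓ ∅ 0 (fun v => v < 0)) (UU_upper _ _ _ _))) ≤
          Submodule.map (Submodule.mkQ _) (PC k (Finset.univ : Finset (Fin n))) := by
        rw [Submodule.smul_le]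
        intro r hr x _
        obtain ⟨g, rfl⟩ := Ideal.Quotient.mk_surjective x
        refine ⟨r * g, Ideal.mul_mem_right _ _ ?_, rfl⟩
        exact (Ideal.span_le.2 hseq : Ideal.ofList _ ≤ _) hr
      rw [← htop] at hle
      obtain ⟨x, hx, hx1⟩ := hle (Submodule.mem_top (x := Ideal.Quotient.mk _ 1))
      have h1 : x - 1 ∈ SQ (UU ℓ ∅ 0 (fun v => v < 0)) (UU_upper _ _ _ _) :=
        (Ideal.Quotient.eq).1 hx1
      have h2 : x - 1 ∈ PC k (Finset.univ : Finset (Fin n)) := by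
        rw [mem_PC]
        intro u hu
        rcases h1 u hu with ⟨c, hc, -⟩ | ⟨i, -, hi, h⟩
        · simp at hc
        · exact ⟨⟨i, by omega⟩, Finset.mem_univ _,
            Finsupp.mem_support_iff.1 (h ⟨i, by omega⟩ le_rfl (by simp) (by simp))⟩
      have h3 := Ideal.sub_mem _ hx h2
      rw [sub_sub_cancel] at h3
      exact hmp.one_notMem h3
  · rintro d ⟨rs, rfl, hrs, hreg⟩
    have hwr := (isWeaklyRegular_iff_WR rs _).1 hreg.toIsWeaklyRegular
    have h1 := WR_length_le (PC k (Finset.univ : Finset (Fin n))) rs _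
      ⟨PC k (CC n ℓ), PC_prime _⟩ (∏ v ∈ (CC n ℓ)ᶜ, MvPolynomial.X v) ?_ ?_ hrs hwr
    · have h2 := h1.trans (coheight_PC _)
      have h3 : rs.length ≤ ((CC n ℓ)ᶜ).card := by exact_mod_cast h2
      exact h3.trans (card_compl_CC n ℓ)
    · intro a
      rw [mul_comm, prod_mul_mem_SQ, mem_PC]
      simp only [CC_colon, Finsupp.mem_support_iff]
    · exact Ideal.span_mono (Set.image_mono (Finset.coe_subset.2 (Finset.subset_univ _)))
end

section
/- Let n ≥ 2 and ℓ ≥ (n-2)/2 with ℓ ≤ n - 2, and let P_ℓ(S_n) ⊆ R = k[x_1,...,x_n] be the ideal of products of ℓ+1 consecutive variables of the path on n vertices. Then depth(R/P_ℓ(S_n)) = n - 2. If ℓ = n - 1, then depth(R/P_ℓ(S_n)) = n - 1. -/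
open scoped Pointwise in
theorem height_add_length_le {R : Type*} [CommRing R] [IsNoetherianRing R]
    (m : Ideal R) [hm : m.IsPrime] (rs : List R) :
    ∀ (M : Type _) [AddCommGroup M] [Module R M] [Module.Finite R M] (P : Ideal R),
      P ∈ associatedPrimes R M → P ≤ m → (∀ r ∈ rs, r ∈ m) →
      RingTheory.Sequence.IsWeaklyRegular M rs →
      P.height + (rs.length : ℕ∞) ≤ m.height := by
  induction rs with
  | nil =>
    intro M _ _ _ P hP hPm _ _
    have := hP.1
    simpa using Ideal.height_mono hPm
  | cons x rs ih =>
    intro M _ _ _ P hP hPm hrs hreg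
    rw [RingTheory.Sequence.isWeaklyRegular_cons_iff] at hreg
    obtain ⟨hx, hreg⟩ := hreg
    have hPp := hP.1
    obtain ⟨_, y, hy⟩ := isAssociatedPrime_iff.mp hP
    have hmemP : ∀ r, r ∈ P ↔ r • y = 0 := by
      intro r; rw [hy]; simp [Submodule.mem_colon_singleton]
    have hxm : x ∈ m := hrs x (by simp)
    have hy0 : y ≠ 0 := by
      rintro rfl
      exact hPp.ne_top ((Ideal.eq_top_iff_one _).mpr ((hmemP 1).mpr (by simp)))
    have hxP : x ∉ P := fun h => hy0 (hx (by simpa using (hmemP x).mp h))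
    let N : Submodule R M := Submodule.torsionBySet R M (P : Set R)
    have hyN : y ∈ N := by
      rw [Submodule.mem_torsionBySet_iff]
      exact fun a => (hmemP a).mp a.2
    have hannN : Module.annihilator R N ≤ m := by
      refine le_trans (fun r hr => ?_) hPm
      rw [Module.mem_annihilator] at hr
      exact (hmemP r).mpr (congrArg Subtype.val (hr ⟨y, hyN⟩))
    let Q' := QuotSMulTop x N
    have hsupp : (⟨m, hm⟩ : PrimeSpectrum R) ∈ Module.support R Q' := by
      rw [Module.support_quotSMulTop]
      refine ⟨Module.mem_support_iff_of_finite.mpr hannN, ?_⟩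
      simpa using hxm
    have hannQ : Module.annihilator R Q' ≤ m := Module.mem_support_iff_of_finite.mp hsupp
    obtain ⟨Q, hQ, hQm⟩ := Ideal.exists_minimalPrimes_le hannQ
    have hQass := Module.associatedPrimes.minimalPrimes_annihilator_subset_associatedPrimes R Q' hQ
    have hinj : Function.Injective (QuotSMulTop.map x N.subtype) := by
      rw [← LinearMap.ker_eq_bot, LinearMap.ker_eq_bot']
      intro z hz
      obtain ⟨z, rfl⟩ := Submodule.mkQ_surjective _ z
      have h1 : (z : M) ∈ x • (⊤ : Submodule R M) := by
        rw [← Submodule.Quotient.mk_eq_zero]; exact hz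
      obtain ⟨w, -, hw⟩ := (Submodule.mem_smul_pointwise_iff_exists _ _ _).mp h1
      have hwN : w ∈ N := by
        rw [Submodule.mem_torsionBySet_iff]
        intro a
        apply hx
        have := (Submodule.mem_torsionBySet_iff _ _).mp z.2 a
        change x • (a : R) • w = x • 0
        rw [smul_comm, hw, smul_zero]; exact this
      rw [Submodule.mkQ_apply, Submodule.Quotient.mk_eq_zero]
      exact (Submodule.mem_smul_pointwise_iff_exists _ _ _).mpr
        ⟨⟨w, hwN⟩, trivial, Subtype.ext hw⟩
    have hQass' : Q ∈ associatedPrimes R (QuotSMulTop x M) :=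
      associatedPrimes.subset_of_injective hinj hQass
    have hQp := hQass.1
    have hAQ : Module.annihilator R Q' ≤ Q := hQ.1.2
    have hPQ : P ≤ Q := by
      refine le_trans (fun r hr => ?_) hAQ
      rw [Module.mem_annihilator]
      intro z
      obtain ⟨z, rfl⟩ := Submodule.mkQ_surjective _ z
      rw [← map_smul]
      have : r • z = 0 := Subtype.ext ((Submodule.mem_torsionBySet_iff _ _).mp z.2 ⟨r, hr⟩)
      rw [this, map_zero]
    have hxQ : x ∈ Q := by
      apply hAQ
      rw [Module.mem_annihilator]
      intro z
      obtain ⟨z, rfl⟩ := Submodule.mkQ_surjective _ z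
      rw [← map_smul, Submodule.mkQ_apply, Submodule.Quotient.mk_eq_zero]
      exact Submodule.smul_mem_pointwise_smul _ _ _ trivial
    have hlt : P < Q := lt_of_le_of_ne hPQ (fun h => hxP (h ▸ hxQ))
    have h1 := Ideal.height_add_one_le_of_lt_of_isPrime hlt
    have h2 := ih (QuotSMulTop x M) Q hQass' hQm (fun r hr => hrs r (by simp [hr])) hreg
    calc P.height + ((x :: rs).length : ℕ∞) = P.height + 1 + (rs.length : ℕ∞) := by
          push_cast [List.length_cons]; ring
      _ ≤ Q.height + (rs.length : ℕ∞) := by gcongr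
      _ ≤ _ := h2

/-- products of `ℓ+1` consecutive elements of a sequence -/
def consIdeal {D : Type*} [CommRing D] (x : ℕ → D) (ℓ e : ℕ) : Ideal D :=
  Ideal.span {p | ∃ i ≤ e, p = ∏ t ∈ Finset.Ico i (i + ℓ + 1), x t}

def bidiag {D : Type*} [CommRing D] (u v : ℕ → D) (e : ℕ) : Ideal D :=
  Ideal.span {p | ∃ i ≤ e, p = (∏ t ∈ Finset.Ico i e, u t) * ∏ t ∈ Finset.range i, v t}

theorem bidiag_succ {D : Type*} [CommRing D] (u v : ℕ → D) (e : ℕ) (p : D) :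
    p ∈ bidiag u v (e + 1) ↔ ∃ q ∈ bidiag u v e, ∃ c, p = u e * q + c * ∏ t ∈ Finset.range (e+1), v t := by
  constructor
  · intro hp
    induction hp using Submodule.span_induction with
    | mem p hp =>
      obtain ⟨i, hi, rfl⟩ := hp
      rcases Nat.lt_or_ge e i with h | h
      · obtain rfl : i = e + 1 := by omega
        exact ⟨0, zero_mem _, 1, by simp⟩
      · refine ⟨_, Ideal.subset_span ⟨i, h, rfl⟩, 0, ?_⟩
        rw [Finset.prod_Ico_succ_top h]; ring
    | zero => exact ⟨0, zero_mem _, 0, by simp⟩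
    | add a b _ _ ha hb =>
      obtain ⟨q, hq, c, rfl⟩ := ha
      obtain ⟨q', hq', c', rfl⟩ := hb
      exact ⟨q + q', add_mem hq hq', c + c', by ring⟩
    | smul r a _ ha =>
      obtain ⟨q, hq, c, rfl⟩ := ha
      exact ⟨r * q, Ideal.mul_mem_left _ _ hq, r * c, by simp only [smul_eq_mul]; ring⟩
  · rintro ⟨q, hq, c, rfl⟩
    refine add_mem ?_ (Ideal.mul_mem_left _ _ (Ideal.subset_span ⟨e + 1, le_rfl, by simp⟩))
    induction hq using Submodule.span_induction with
    | mem p hp =>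
      obtain ⟨i, hi, rfl⟩ := hp
      refine Ideal.subset_span ⟨i, by omega, ?_⟩
      rw [Finset.prod_Ico_succ_top hi]; ring
    | zero => simp
    | add a b _ _ ha hb => rw [mul_add]; exact add_mem ha hb
    | smul r a _ ha =>
      rw [smul_eq_mul, mul_left_comm]; exact Ideal.mul_mem_left _ _ ha

theorem bidiag_regular {D : Type*} [CommRing D] [IsDomain D] (a : D) (ha : Prime a) (u v : ℕ → D)
    (e : ℕ) (hu : ∀ i < e, ¬ a ∣ u i)
    (huv : ∀ i < e, ∀ j < e, ∀ w, v j * w ∈ Ideal.span {a, u i} → w ∈ Ideal.span {a, u i}) :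
    ∀ h, a * h ∈ bidiag u v e → h ∈ bidiag u v e := by
  induction e with
  | zero =>
    intro h _
    have : (1 : D) ∈ bidiag u v 0 := Ideal.subset_span ⟨0, le_rfl, by simp⟩
    rw [(Ideal.eq_top_iff_one _).mpr this]; trivial
  | succ e ih =>
    intro h hh
    obtain ⟨p, hp, c, hpc⟩ := (bidiag_succ u v e _).mp hh
    have hprod : ∀ s ≤ e + 1, ∀ w, (∏ t ∈ Finset.range s, v t) * w ∈ Ideal.span {a, u e} →
        w ∈ Ideal.span {a, u e} := by
      intro s
      induction s with
      | zero => intro _ w hw; simpa using hw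
      | succ s ihs =>
        intro hs w hw
        rw [Finset.prod_range_succ, mul_assoc] at hw
        exact huv e (by omega) s (by omega) _ (ihs (by omega) _ hw)
    have hc : c ∈ Ideal.span {a, u e} := by
      apply hprod (e + 1) le_rfl
      rw [Ideal.mem_span_pair]
      exact ⟨h, -p, by linear_combination hpc⟩
    obtain ⟨α, β, rfl⟩ := Ideal.mem_span_pair.mp hc
    have hV : (∏ t ∈ Finset.range e, v t) ∈ bidiag u v e :=
      Ideal.subset_span ⟨e, le_rfl, by simp⟩
    set V := ∏ t ∈ Finset.range (e + 1), v t with hVdef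
    have hq : p + β * V ∈ bidiag u v e := by
      refine add_mem hp ?_
      rw [hVdef, Finset.prod_range_succ]
      have := Ideal.mul_mem_left _ (β * v e) hV
      convert this using 1; ring
    have heq : a * (h - α * V) = u e * (p + β * V) := by linear_combination hpc
    obtain ⟨q, hq'⟩ := (ha.dvd_or_dvd (Dvd.intro _ heq)).resolve_left (hu e (by omega))
    have hqm : q ∈ bidiag u v e := by
      apply ih (fun i hi => hu i (by omega)) (fun i hi j hj => huv i (by omega) j (by omega))
      rwa [← hq']
    refine (bidiag_succ u v e _).mpr ⟨q, hqm, α, ?_⟩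
    apply mul_left_cancel₀ ha.ne_zero
    rw [hq'] at heq
    linear_combination heq

theorem consIdeal_mem {D : Type*} [CommRing D] (x : ℕ → D) (ℓ e : ℕ) (he : e ≤ ℓ + 1) (p : D) :
    p ∈ consIdeal x ℓ e ↔ ∃ q ∈ bidiag x (fun j => x (ℓ + 1 + j)) e,
      p = (∏ t ∈ Finset.Ico e (ℓ + 1), x t) * q := by
  have key : ∀ i ≤ e, ∏ t ∈ Finset.Ico i (i + ℓ + 1), x t =
      (∏ t ∈ Finset.Ico e (ℓ + 1), x t) *
        ((∏ t ∈ Finset.Ico i e, x t) * ∏ t ∈ Finset.range i, x (ℓ + 1 + t)) := by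
    intro i hi
    rw [← Finset.prod_Ico_consecutive x (m := i) (n := ℓ + 1) (by omega) (by omega),
      ← Finset.prod_Ico_consecutive x (m := i) (n := e) hi he,
      Finset.prod_Ico_eq_prod_range x (ℓ + 1)]
    rw [show i + ℓ + 1 - (ℓ + 1) = i by omega]
    ring
  constructor
  · intro hp
    induction hp using Submodule.span_induction with
    | mem p hp =>
      obtain ⟨i, hi, rfl⟩ := hp
      exact ⟨_, Ideal.subset_span ⟨i, hi, rfl⟩, key i hi⟩
    | zero => exact ⟨0, zero_mem _, by simp⟩
    | add a b _ _ ha hb =>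
      obtain ⟨q, hq, rfl⟩ := ha
      obtain ⟨q', hq', rfl⟩ := hb
      exact ⟨q + q', add_mem hq hq', by ring⟩
    | smul r a _ ha =>
      obtain ⟨q, hq, rfl⟩ := ha
      exact ⟨r * q, Ideal.mul_mem_left _ _ hq, by simp only [smul_eq_mul]; ring⟩
  · rintro ⟨q, hq, rfl⟩
    induction hq using Submodule.span_induction with
    | mem p hp =>
      obtain ⟨i, hi, rfl⟩ := hp
      exact Ideal.subset_span ⟨i, hi, (key i hi).symm⟩
    | zero => simp
    | add a b _ _ ha hb => rw [mul_add]; exact add_mem ha hb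
    | smul r a _ ha =>
      rw [smul_eq_mul, mul_left_comm]; exact Ideal.mul_mem_left _ _ ha

theorem consIdeal_regular {D : Type*} [CommRing D] [IsDomain D] (a : D) (ha : Prime a)
    (x : ℕ → D) (ℓ e : ℕ) (he : e ≤ ℓ + 1) (hu : ∀ i ≤ ℓ, ¬ a ∣ x i)
    (huv : ∀ i ≤ ℓ, ∀ j < e, ∀ w, x (ℓ + 1 + j) * w ∈ Ideal.span {a, x i} →
      w ∈ Ideal.span {a, x i}) (h : D) (hh : a * h ∈ consIdeal x ℓ e) :
    h ∈ consIdeal x ℓ e := by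
  obtain ⟨q, hq, heq⟩ := (consIdeal_mem x ℓ e he _).mp hh
  have hC : ¬ a ∣ ∏ t ∈ Finset.Ico e (ℓ + 1), x t := by
    intro hd
    obtain ⟨t, ht, hd⟩ := (ha.dvd_finsetProd_iff _).mp hd
    exact hu t (by simp at ht; omega) hd
  obtain ⟨q', rfl⟩ := (ha.dvd_or_dvd (Dvd.intro _ heq)).resolve_left hC
  refine (consIdeal_mem x ℓ e he _).mpr ⟨q', ?_, ?_⟩
  · exact bidiag_regular a ha _ _ e (fun i hi => hu i (by omega))
      (fun i hi j hj => huv i (by omega) j hj) _ hq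
  · apply mul_left_cancel₀ ha.ne_zero
    linear_combination heq

open MvPolynomial in
theorem retract_mem {k : Type*} [Field k] {n : ℕ}
    (φ : MvPolynomial (Fin n) k →ₐ[k] MvPolynomial (Fin n) k) (K : Ideal (MvPolynomial (Fin n) k))
    (hK : ∀ v, X v - φ (X v) ∈ K) (w : MvPolynomial (Fin n) k) : w - φ w ∈ K := by
  have : Ideal.Quotient.mkₐ k K = (Ideal.Quotient.mkₐ k K).comp φ := by
    apply MvPolynomial.algHom_ext
    intro v
    simpa [Ideal.Quotient.mk_eq_mk_iff_sub_mem] using hK v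
  have h := DFunLike.congr_fun this w
  simpa [Ideal.Quotient.mk_eq_mk_iff_sub_mem] using h

open MvPolynomial in
theorem prime_X_sub_X (k : Type*) [Field k] {n : ℕ} {p q : Fin n} (hpq : p ≠ q) :
    Prime (X p - X q : MvPolynomial (Fin n) k) ∧
      ∀ i, ¬ (X p - X q : MvPolynomial (Fin n) k) ∣ X i := by
  let φ : MvPolynomial (Fin n) k →ₐ[k] MvPolynomial (Fin n) k :=
    aeval (fun v => if v = p then X q else X v)
  have hφa : φ (X p - X q) = 0 := by simp [φ, hpq.symm]
  have hφX : ∀ i, φ (X i) ≠ 0 := by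
    intro i
    simp only [φ, aeval_X]
    split_ifs <;> exact X_ne_zero _
  have hker : ∀ w, φ w = 0 → (X p - X q) ∣ w := by
    intro w hw
    have := retract_mem φ (Ideal.span {X p - X q}) (fun v => by
      simp only [φ, aeval_X]
      split_ifs with h
      · subst h; exact Ideal.mem_span_singleton_self _
      · simp) w
    rw [hw, sub_zero] at this
    exact Ideal.mem_span_singleton.mp this
  have hdvd : ∀ w, (X p - X q) ∣ w → φ w = 0 := by
    rintro _ ⟨c, rfl⟩
    rw [map_mul, hφa, zero_mul]
  refine ⟨⟨?_, ?_, ?_⟩, fun i hi => hφX i (hdvd _ hi)⟩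
  · rw [sub_ne_zero]
    exact fun h => hpq (X_injective h)
  · intro hu
    have := hu.map φ
    rw [hφa] at this
    exact not_isUnit_zero this
  · intro f g hfg
    have := hdvd _ hfg
    rw [map_mul, mul_eq_zero] at this
    exact this.imp (hker _) (hker _)

open MvPolynomial in
theorem X_regular_mod_pair (k : Type*) [Field k] {n : ℕ} (s : Fin n → Prop) {p q m m' : Fin n}
    (hpq : s p ↔ s q) (hm : s m) (hm' : ¬ s m') (w : MvPolynomial (Fin n) k)
    (hw : X m' * w ∈ Ideal.span {(X p - X q : MvPolynomial (Fin n) k), X m}) :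
    w ∈ Ideal.span {(X p - X q : MvPolynomial (Fin n) k), X m} := by
  let ρ : Fin n → Fin n := fun v => if v = p then q else v
  have hρs : ∀ v, s (ρ v) ↔ s v := by
    intro v
    simp only [ρ]
    split_ifs with h
    · rw [h, hpq]
    · rfl
  let φ : MvPolynomial (Fin n) k →ₐ[k] MvPolynomial (Fin n) k :=
    aeval (fun v => if ρ v = ρ m then 0 else X (ρ v))
  set K := Ideal.span {(X p - X q : MvPolynomial (Fin n) k), X m} with hK
  have ha : (X p - X q : MvPolynomial (Fin n) k) ∈ K := Ideal.subset_span (by simp)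
  have hXm : (X m : MvPolynomial (Fin n) k) ∈ K := Ideal.subset_span (by simp)
  have hρK : ∀ v, (X v - X (ρ v) : MvPolynomial (Fin n) k) ∈ K := by
    intro v
    simp only [ρ]
    split_ifs with h
    · rw [h]; exact ha
    · simp
  have hφ : φ (X p - X q) = 0 := by
    have : ρ p = ρ q := by simp [ρ]
    simp [φ, this]
  have hφm : φ (X m) = 0 := by simp [φ]
  have hφm' : φ (X m') ≠ 0 := by
    have : ρ m' ≠ ρ m := fun h => hm' ((hρs m').mp (h ▸ (hρs m).mpr hm))
    simp only [φ, aeval_X, if_neg this]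
    exact X_ne_zero _
  have hw0 : φ w = 0 := by
    obtain ⟨c, d, hcd⟩ := Ideal.mem_span_pair.mp hw
    have := congrArg φ hcd
    simp only [map_add, map_mul, hφ, hφm, mul_zero, add_zero] at this
    exact (mul_eq_zero.mp this.symm).resolve_left hφm'
  have := retract_mem φ K (fun v => by
    simp only [φ, aeval_X]
    split_ifs with h
    · have h1 := hρK v
      have h2 := hρK m
      rw [h] at h1
      have := add_mem (sub_mem h1 h2) hXm
      convert this using 1; ring
    · exact hρK v) w
  rwa [hw0, sub_zero] at this

/-- the variables as a sequence indexed by `ℕ` -/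
noncomputable def xs (k : Type*) [Field k] (n : ℕ) (t : ℕ) : MvPolynomial (Fin n) k :=
  if h : t < n then MvPolynomial.X ⟨t, h⟩ else 1

theorem prod_xs (k : Type*) [Field k] (n ℓ i : ℕ) (hi : i + ℓ < n) :
    ∏ v ∈ Finset.univ.filter
      (fun v : Fin n => i ≤ (v : ℕ) ∧ (v : ℕ) ≤ i + ℓ), (MvPolynomial.X v : MvPolynomial (Fin n) k)
      = ∏ t ∈ Finset.Ico i (i + ℓ + 1), xs k n t := by
  refine Finset.prod_bij (fun v _ => (v : ℕ)) ?_ ?_ ?_ ?_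
  · intro v hv; simp at hv ⊢; omega
  · intro a _ b _ h; exact Fin.ext h
  · intro t ht
    simp at ht
    exact ⟨⟨t, by omega⟩, by simp; omega, rfl⟩
  · intro v _
    simp [xs]

theorem spine_eq_s17 (k : Type*) [Field k] (n ℓ : ℕ) (h : ℓ < n) :
    spinePathIdeal k n ℓ = consIdeal (xs k n) ℓ (n - ℓ - 1) := by
  unfold spinePathIdeal consIdeal
  congr 1
  ext p
  simp only [Set.mem_image, Set.mem_ofPred_eq]
  constructor
  · rintro ⟨i, hi, rfl⟩
    exact ⟨i, by omega, prod_xs k n ℓ i hi⟩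
  · rintro ⟨i, hi, rfl⟩
    exact ⟨i, by omega, prod_xs k n ℓ i (by omega)⟩

theorem map_consIdeal {D E : Type*} [CommRing D] [CommRing E] (φ : D →+* E) (x : ℕ → D) (ℓ e : ℕ) :
    (consIdeal x ℓ e).map φ = consIdeal (fun t => φ (x t)) ℓ e := by
  unfold consIdeal
  rw [Ideal.map_span]
  congr 1
  ext p
  simp only [Set.mem_image, Set.mem_ofPred_eq]
  constructor
  · rintro ⟨_, ⟨i, hi, rfl⟩, rfl⟩
    exact ⟨i, hi, by rw [map_prod]⟩
  · rintro ⟨i, hi, rfl⟩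
    exact ⟨_, ⟨i, hi, rfl⟩, by rw [map_prod]⟩

open MvPolynomial in
theorem stage_regular (k : Type*) [Field k] (n ℓ : ℕ) (h : ℓ < n) (h2 : n ≤ 2 * ℓ + 2)
    (b : Fin n → Fin n) (hbb : ∀ v, b (b v) = b v)
    (hs : ∀ v, (b v : ℕ) ≤ ℓ ↔ (v : ℕ) ≤ ℓ)
    (js : List (Fin n)) (hjs : ∀ j ∈ js, b j ≠ j) (j : Fin n) (hj : b j ≠ j) (hjn : j ∉ js)
    (w : MvPolynomial (Fin n) k)
    (hw : (X j - X (b j)) * w ∈ spinePathIdeal k n ℓ ⊔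
      Ideal.ofList (js.map fun v => (X v - X (b v) : MvPolynomial (Fin n) k))) :
    w ∈ spinePathIdeal k n ℓ ⊔
      Ideal.ofList (js.map fun v => (X v - X (b v) : MvPolynomial (Fin n) k)) := by
  classical
  set K := Ideal.ofList (js.map fun v => (X v - X (b v) : MvPolynomial (Fin n) k)) with hK
  let σ : Fin n → Fin n := fun v => if v ∈ js then b v else v
  have hbjs : ∀ v, b v ∉ js := fun v hv => hjs _ hv (hbb v)
  let φ : MvPolynomial (Fin n) k →ₐ[k] MvPolynomial (Fin n) k := rename σ
  have hφX : ∀ v, φ (X v) = X (σ v) := fun v => rename_X _ _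
  have hσs : ∀ v, (σ v : ℕ) ≤ ℓ ↔ (v : ℕ) ≤ ℓ := by
    intro v
    simp only [σ]
    split_ifs
    · exact hs v
    · rfl
  have hret : ∀ w, w - φ w ∈ K := by
    apply retract_mem
    intro v
    rw [hφX]
    simp only [σ]
    split_ifs with hv
    · exact Ideal.subset_span (by simpa using ⟨v, hv, rfl⟩)
    · simp
  have hφK : K.map φ.toRingHom = ⊥ := by
    rw [hK, Ideal.ofList, Ideal.map_span, Ideal.span_eq_bot]
    rintro _ ⟨_, hx, rfl⟩
    obtain ⟨v, hv, rfl⟩ := List.mem_map.mp hx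
    change φ (X v - X (b v)) = 0
    rw [map_sub, hφX, hφX]
    simp [σ, hv, hbjs v]
  rw [spine_eq_s17 k n ℓ h] at hw ⊢
  set I := consIdeal (xs k n) ℓ (n - ℓ - 1) with hI
  have hmap : I.map φ.toRingHom = consIdeal (fun t => φ (xs k n t)) ℓ (n - ℓ - 1) :=
    map_consIdeal φ.toRingHom _ _ _
  have h1 : φ ((X j - X (b j)) * w) ∈ I.map φ.toRingHom := by
    have := Ideal.mem_map_of_mem φ.toRingHom hw
    rw [Ideal.map_sup, hφK, sup_bot_eq] at this
    exact this
  have hφa : φ (X j - X (b j)) = X j - X (b j) := by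
    rw [map_sub, hφX, hφX]
    simp [σ, hjn, hbjs]
  rw [map_mul, hφa, hmap] at h1
  have hxs : ∀ t (ht : t < n), φ (xs k n t) = X (σ ⟨t, ht⟩) := by
    intro t ht
    simp only [xs, ht, dif_pos, hφX]
  obtain ⟨hprime, hnd⟩ := prime_X_sub_X k (Ne.symm hj)
  have h3 : φ w ∈ I.map φ.toRingHom := by
    rw [hmap]
    refine consIdeal_regular _ hprime _ ℓ _ (by omega) ?_ ?_ _ h1
    · intro i hi
      rw [hxs i (by omega)]
      exact hnd _
    · intro i hi t ht w' hw'
      rw [hxs i (by omega)] at hw' ⊢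
      rw [hxs (ℓ + 1 + t) (by omega)] at hw'
      refine X_regular_mod_pair k (fun v => (v : ℕ) ≤ ℓ) (hs j).symm ((hσs _).mpr hi) ?_ w' hw'
      rw [hσs]; simp; omega
  have h4 : I.map φ.toRingHom ≤ I ⊔ K := by
    rw [Ideal.map_le_iff_le_comap]
    intro g hg
    change φ g ∈ I ⊔ K
    have : φ g = g - (g - φ g) := by ring
    rw [this]
    exact sub_mem (Ideal.mem_sup_left hg) (Ideal.mem_sup_right (hret g))
  have : w = φ w + (w - φ w) := by ring
  rw [this]
  exact add_mem (h4 h3) (Ideal.mem_sup_right (hret w))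

theorem mk_mem_smul_top {R : Type*} [CommRing R] (I K : Ideal R) (w : R) :
    (Submodule.Quotient.mk w : R ⧸ I) ∈ (K • ⊤ : Submodule R (R ⧸ I)) ↔ w ∈ I ⊔ K := by
  have h1 : (K • ⊤ : Submodule R (R ⧸ I)) = Submodule.map (Submodule.mkQ I) K := by
    have := Submodule.map_smul'' K (⊤ : Submodule R R) (Submodule.mkQ I)
    rw [Submodule.map_top, Submodule.range_mkQ] at this
    rw [← this]
    simp
  rw [h1, ← Submodule.comap_map_mkQ I K]
  rfl

/-- the irrelevant ideal is a kernel -/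
theorem irr_eq (k : Type*) [Field k] (n : ℕ) :
    Ideal.span (Set.range (MvPolynomial.X : Fin n → MvPolynomial (Fin n) k)) =
      RingHom.ker (MvPolynomial.constantCoeff (σ := Fin n) (R := k)) := by
  apply le_antisymm
  · rw [Ideal.span_le]
    rintro _ ⟨i, rfl⟩
    simp [RingHom.mem_ker]
  · intro w hw
    rw [RingHom.mem_ker] at hw
    have := retract_mem (MvPolynomial.aeval (fun _ => 0)) (Ideal.span (Set.range
      (MvPolynomial.X : Fin n → MvPolynomial (Fin n) k))) (fun v => by
        simpa using Ideal.subset_span (Set.mem_range_self v)) w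
    have h0 : MvPolynomial.aeval (fun _ => (0 : MvPolynomial (Fin n) k)) w = 0 := by
      have := MvPolynomial.aeval_zero (R := k) (S₁ := MvPolynomial (Fin n) k) w
      rw [hw, map_zero] at this
      exact this
    rwa [h0, sub_zero] at this

theorem spine_le_irr (k : Type*) [Field k] (n ℓ : ℕ) :
    spinePathIdeal k n ℓ ≤
      Ideal.span (Set.range (MvPolynomial.X : Fin n → MvPolynomial (Fin n) k)) := by
  unfold spinePathIdeal
  rw [Ideal.span_le]
  rintro _ ⟨i, hi, rfl⟩
  simp only [Set.mem_ofPred_eq] at hi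
  exact Ideal.mem_of_dvd _ (Finset.dvd_prod_of_mem _ (a := (⟨i, by omega⟩ : Fin n)) (by simp))
    (Ideal.subset_span ⟨_, rfl⟩)

open MvPolynomial in
theorem list_regular (k : Type*) [Field k] (n ℓ : ℕ) (h : ℓ < n) (h2 : n ≤ 2 * ℓ + 2)
    (b : Fin n → Fin n) (hbb : ∀ v, b (b v) = b v)
    (hs : ∀ v, (b v : ℕ) ≤ ℓ ↔ (v : ℕ) ≤ ℓ)
    (js : List (Fin n)) (hnd : js.Nodup) (hjs : ∀ j ∈ js, b j ≠ j) :
    (∀ r ∈ js.map fun v => (X v - X (b v) : MvPolynomial (Fin n) k),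
      r ∈ Ideal.span (Set.range (X : Fin n → MvPolynomial (Fin n) k))) ∧
    RingTheory.Sequence.IsRegular (MvPolynomial (Fin n) k ⧸ spinePathIdeal k n ℓ)
      (js.map fun v => (X v - X (b v) : MvPolynomial (Fin n) k)) := by
  have hmem : ∀ r ∈ js.map fun v => (X v - X (b v) : MvPolynomial (Fin n) k),
      r ∈ Ideal.span (Set.range (X : Fin n → MvPolynomial (Fin n) k)) := by
    intro r hr
    obtain ⟨v, _, rfl⟩ := List.mem_map.mp hr
    exact sub_mem (Ideal.subset_span ⟨_, rfl⟩) (Ideal.subset_span ⟨_, rfl⟩)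
  refine ⟨hmem, ⟨⟨?_⟩, ?_⟩⟩
  · intro i hi
    rw [isSMulRegular_quotient_iff_mem_of_smul_mem]
    intro y hy
    obtain ⟨w, rfl⟩ := Submodule.mkQ_surjective _ y
    rw [← map_smul] at hy
    rw [Submodule.mkQ_apply, mk_mem_smul_top] at hy ⊢
    rw [List.getElem_map, smul_eq_mul, ← List.map_take] at hy
    rw [← List.map_take]
    have hi' : i < js.length := by simpa using hi
    refine stage_regular k n ℓ h h2 b hbb hs _ (fun j hj => hjs j (List.mem_of_mem_take hj)) _
      (hjs _ (List.getElem_mem hi')) ?_ w hy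
    intro hmem
    obtain ⟨t, ht, hte⟩ := List.mem_take_iff_getElem.mp hmem
    have := (hnd.getElem_inj_iff).mp hte
    omega
  · intro htop
    have h1 : (Submodule.Quotient.mk 1 : MvPolynomial (Fin n) k ⧸ spinePathIdeal k n ℓ) ∈
        (⊤ : Submodule (MvPolynomial (Fin n) k) _) := trivial
    rw [htop, mk_mem_smul_top] at h1
    have h3 : spinePathIdeal k n ℓ ⊔ Ideal.ofList (js.map fun v =>
        (X v - X (b v) : MvPolynomial (Fin n) k)) ≤
        Ideal.span (Set.range (X : Fin n → MvPolynomial (Fin n) k)) := by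
      refine sup_le (spine_le_irr k n ℓ) ?_
      rw [Ideal.ofList, Ideal.span_le]
      exact fun r hr => hmem r hr
    have h4 := h3 h1
    rw [irr_eq, RingHom.mem_ker] at h4
    simp at h4

open MvPolynomial in
theorem span_X_isPrime (k : Type*) [Field k] {n : ℕ} (T : Set (Fin n)) :
    (Ideal.span (X '' T : Set (MvPolynomial (Fin n) k))).IsPrime ∧
      ∀ v, (X v : MvPolynomial (Fin n) k) ∈ Ideal.span (X '' T) → v ∈ T := by
  classical
  let φ : MvPolynomial (Fin n) k →ₐ[k] MvPolynomial (Fin n) k :=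
    aeval (fun v => if v ∈ T then 0 else X v)
  have hker : Ideal.span (X '' T : Set (MvPolynomial (Fin n) k)) = RingHom.ker φ := by
    apply le_antisymm
    · rw [Ideal.span_le]
      rintro _ ⟨v, hv, rfl⟩
      simp [RingHom.mem_ker, φ, hv]
    · intro w hw
      rw [RingHom.mem_ker] at hw
      have := retract_mem φ (Ideal.span (X '' T)) (fun v => by
        simp only [φ, aeval_X]
        split_ifs with h
        · rw [sub_zero]; exact Ideal.subset_span ⟨v, h, rfl⟩
        · simp) w
      rwa [hw, sub_zero] at this
  rw [hker]
  refine ⟨RingHom.ker_isPrime _, fun v hv => ?_⟩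
  by_contra hvT
  rw [RingHom.mem_ker] at hv
  simp [φ, hvT] at hv

open MvPolynomial in
theorem spine_assoc (k : Type*) [Field k] (n ℓ : ℕ) (h : ℓ < n) (h2 : n ≤ 2 * ℓ + 2) :
    Ideal.span (X '' {v : Fin n | (v : ℕ) = 0 ∨ (v : ℕ) = ℓ + 1} : Set (MvPolynomial (Fin n) k)) ∈
      associatedPrimes (MvPolynomial (Fin n) k)
        (MvPolynomial (Fin n) k ⧸ spinePathIdeal k n ℓ) := by
  classical
  set T : Set (Fin n) := {v : Fin n | (v : ℕ) = 0 ∨ (v : ℕ) = ℓ + 1} with hT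
  obtain ⟨hprime, hXT⟩ := span_X_isPrime k T
  set P := Ideal.span (X '' T : Set (MvPolynomial (Fin n) k)) with hP
  let f : MvPolynomial (Fin n) k := ∏ v ∈ Finset.univ.filter (fun v => v ∉ T), X v
  have hf : f ∉ P := by
    intro hf
    obtain ⟨v, hv, hvP⟩ := (hprime.prod_mem_iff).mp hf
    exact (Finset.mem_filter.mp hv).2 (hXT v hvP)
  have hIP : spinePathIdeal k n ℓ ≤ P := by
    unfold spinePathIdeal
    rw [Ideal.span_le]
    rintro _ ⟨i, hi, rfl⟩
    have hi : i + ℓ < n := hi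
    rcases Nat.eq_zero_or_pos i with h0 | h0
    · exact Ideal.mem_of_dvd _
        (Finset.dvd_prod_of_mem _ (a := (⟨0, by omega⟩ : Fin n)) (by simp [h0]))
        (Ideal.subset_span ⟨_, by simp [hT], rfl⟩)
    · exact Ideal.mem_of_dvd _
        (Finset.dvd_prod_of_mem _ (a := (⟨ℓ + 1, by omega⟩ : Fin n)) (by simp; omega))
        (Ideal.subset_span ⟨_, by simp [hT], rfl⟩)
  have hTf : ∀ v ∈ T, X v * f ∈ spinePathIdeal k n ℓ := by
    intro v hv
    have hXf : X v * f = ∏ t ∈ insert v (Finset.univ.filter (fun v => v ∉ T)), X t := by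
      rw [Finset.prod_insert (by simpa using hv)]
    have hdvd : ∀ i, i + ℓ < n → (∀ t : Fin n, i ≤ (t : ℕ) → (t : ℕ) ≤ i + ℓ → t = v ∨ t ∉ T) →
        X v * f ∈ spinePathIdeal k n ℓ := by
      intro i hi hsub
      refine Ideal.mem_of_dvd _ ?_ (Ideal.subset_span ⟨i, hi, rfl⟩)
      rw [hXf]
      apply Finset.prod_dvd_prod_of_subset
      intro t ht
      simp only [Finset.mem_filter, Finset.mem_univ, true_and] at ht
      simp only [Finset.mem_insert, Finset.mem_filter, Finset.mem_univ, true_and]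
      exact hsub t ht.1 ht.2
    rcases hv with hv | hv
    · refine hdvd 0 (by omega) (fun t h1 h3 => ?_)
      by_cases ht : (t : ℕ) = 0
      · left; exact Fin.ext (by omega)
      · right; rintro (h4 | h4) <;> omega
    · have := v.2
      refine hdvd 1 (by omega) (fun t h1 h3 => ?_)
      by_cases ht : (t : ℕ) = ℓ + 1
      · left; exact Fin.ext (by omega)
      · right; rintro (h4 | h4) <;> omega
  refine isAssociatedPrime_iff.mpr ⟨hprime, Submodule.Quotient.mk f, ?_⟩
  ext r
  rw [Submodule.mem_colon_singleton, Submodule.mem_bot, ← Submodule.Quotient.mk_smul,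
    Submodule.Quotient.mk_eq_zero, smul_eq_mul]
  constructor
  · intro hr
    induction hr using Submodule.span_induction with
    | mem p hp =>
      obtain ⟨v, hv, rfl⟩ := hp
      exact hTf v hv
    | zero => simp
    | add a b _ _ ha hb => rw [add_mul]; exact add_mem ha hb
    | smul c a _ ha => rw [smul_eq_mul, mul_assoc]; exact Ideal.mul_mem_left _ _ ha
  · intro hr
    exact (hprime.mem_or_mem (hIP hr)).resolve_right hf

open MvPolynomial in
theorem upper_bound (k : Type*) [Field k] (n ℓ : ℕ) (h : ℓ < n) (h2 : n ≤ 2 * ℓ + 2)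
    (c : ℕ) (hc : (c : ℕ∞) ≤ (Ideal.span (X '' {v : Fin n | (v : ℕ) = 0 ∨ (v : ℕ) = ℓ + 1} :
      Set (MvPolynomial (Fin n) k))).height)
    (rs : List (MvPolynomial (Fin n) k)) (hrs : ∀ r ∈ rs, r ∈ Ideal.span
      (Set.range (MvPolynomial.X : Fin n → MvPolynomial (Fin n) k)))
    (hreg : RingTheory.Sequence.IsRegular (MvPolynomial (Fin n) k ⧸ spinePathIdeal k n ℓ) rs) :
    c + rs.length ≤ n := by
  have hm : (Ideal.span
      (Set.range (MvPolynomial.X : Fin n → MvPolynomial (Fin n) k))).IsPrime := by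
    rw [irr_eq]; exact RingHom.ker_isPrime _
  have h1 := height_add_length_le _ rs _ _ (spine_assoc k n ℓ h h2)
    (Ideal.span_mono (Set.image_subset_range _ _)) hrs hreg.toIsWeaklyRegular
  have h3 := (Ideal.span
    (Set.range (MvPolynomial.X : Fin n → MvPolynomial (Fin n) k))).height_le_ringKrullDim_of_isPrime
  rw [MvPolynomial.ringKrullDim_of_isNoetherianRing, ringKrullDim_eq_zero_of_field, zero_add,
    Nat.card_fin] at h3
  have h4 : (Ideal.span
    (Set.range (MvPolynomial.X : Fin n → MvPolynomial (Fin n) k))).height ≤ (n : ℕ∞) := by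
    exact_mod_cast h3
  have h5 : (c : ℕ∞) + (rs.length : ℕ∞) ≤ (n : ℕ∞) :=
    le_trans (by gcongr) (h1.trans h4)
  exact_mod_cast h5

open MvPolynomial in
theorem one_le_height (k : Type*) [Field k] (n : ℕ) (v : Fin n) :
    (1 : ℕ∞) ≤ (Ideal.span (X '' {v} : Set (MvPolynomial (Fin n) k))).height := by
  have := (span_X_isPrime k {v}).1
  have hlt : (⊥ : Ideal (MvPolynomial (Fin n) k)) < Ideal.span (X '' {v}) := by
    rw [bot_lt_iff_ne_bot]
    intro h0
    have : (X v : MvPolynomial (Fin n) k) ∈ Ideal.span (X '' {v}) :=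
      Ideal.subset_span ⟨v, rfl, rfl⟩
    rw [h0] at this
    exact X_ne_zero v this
  have hb : (⊥ : Ideal (MvPolynomial (Fin n) k)).IsPrime := Ideal.isPrime_bot
  exact le_trans le_add_self (Ideal.height_add_one_le_of_lt_of_isPrime hlt)

open MvPolynomial in
theorem two_le_height (k : Type*) [Field k] (n : ℕ) (T : Set (Fin n)) (v w : Fin n) (hv : v ∈ T)
    (hw : w ∈ T) (hvw : w ≠ v) :
    (2 : ℕ∞) ≤ (Ideal.span (X '' T : Set (MvPolynomial (Fin n) k))).height := by
  have h1 := span_X_isPrime k {v}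
  have := h1.1
  have := (span_X_isPrime k T).1
  have hlt : Ideal.span (X '' {v} : Set (MvPolynomial (Fin n) k)) < Ideal.span (X '' T) := by
    refine lt_of_le_of_ne (Ideal.span_mono (Set.image_mono (by simpa using hv))) ?_
    intro h0
    have h3 : (X w : MvPolynomial (Fin n) k) ∈ Ideal.span (X '' T) :=
      Ideal.subset_span ⟨w, hw, rfl⟩
    rw [← h0] at h3
    exact hvw (h1.2 w h3)
  refine le_trans ?_ (Ideal.height_add_one_le_of_lt_of_isPrime hlt)
  have h4 := one_le_height k n v
  calc (2 : ℕ∞) = 1 + 1 := by norm_num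
    _ ≤ _ := by gcongr

theorem depth_eq (k : Type*) [Field k] (n ℓ : ℕ) (h : ℓ < n) (h2 : n ≤ 2 * ℓ + 2)
    (c : ℕ) (hc : (c : ℕ∞) ≤ (Ideal.span (MvPolynomial.X ''
      {v : Fin n | (v : ℕ) = 0 ∨ (v : ℕ) = ℓ + 1} : Set (MvPolynomial (Fin n) k))).height)
    (b : Fin n → Fin n) (hbb : ∀ v, b (b v) = b v)
    (hs : ∀ v, (b v : ℕ) ≤ ℓ ↔ (v : ℕ) ≤ ℓ)
    (js : Finset (Fin n)) (hjs : ∀ j ∈ js, b j ≠ j) (hcard : js.card = n - c) :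
    quotientDepth k (spinePathIdeal k n ℓ) = n - c := by
  unfold quotientDepth
  apply IsGreatest.csSup_eq
  constructor
  · obtain ⟨h3, h4⟩ := list_regular k n ℓ h h2 b hbb hs js.toList js.nodup_toList
      (fun j hj => hjs j (Finset.mem_toList.mp hj))
    exact ⟨_, by simp [hcard], h3, h4⟩
  · rintro d ⟨rs, rfl, hrs, hreg⟩
    have := upper_bound k n ℓ h h2 c hc rs hrs hreg
    omega

/-- If `ℓ ≥ (n-2)/2` then `depth (R/P_ℓ(S_n)) = n - 2` provided `ℓ ≤ n - 2`,
while `depth (R/P_ℓ(S_n)) = n - 1` when `ℓ = n - 1`. -/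
theorem depth_spinePathIdeal_large_ell (k : Type*) [Field k] (n ℓ : ℕ)
    (hn : 2 ≤ n) (hℓ : 1 ≤ ℓ) (h : n - 2 ≤ 2 * ℓ) :
    (ℓ ≤ n - 2 → quotientDepth k (spinePathIdeal k n ℓ) = n - 2) ∧
    (ℓ = n - 1 → quotientDepth k (spinePathIdeal k n ℓ) = n - 1) := by
  constructor
  · intro hle
    let z : Fin n := ⟨0, by omega⟩
    let y : Fin n := ⟨ℓ + 1, by omega⟩
    have hzy : y ≠ z := by simp [z, y, Fin.ext_iff]
    refine depth_eq k n ℓ (by omega) (by omega) 2 ?_ (fun v => if (v : ℕ) ≤ ℓ then z else y)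
      ?_ ?_ {z, y}ᶜ ?_ ?_
    · exact two_le_height k n _ z y (by simp [z]) (by simp [y]) hzy
    · intro v
      by_cases hv : (v : ℕ) ≤ ℓ <;> simp [hv, z, y]
    · intro v
      by_cases hv : (v : ℕ) ≤ ℓ <;> simp [hv, z, y]
    · intro j hj
      simp only [Finset.mem_compl, Finset.mem_insert, Finset.mem_singleton, not_or] at hj
      split_ifs
      · exact Ne.symm hj.1
      · exact Ne.symm hj.2
    · rw [Finset.card_compl, Finset.card_pair hzy.symm, Fintype.card_fin]
  · intro hle
    let z : Fin n := ⟨0, by omega⟩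
    refine depth_eq k n ℓ (by omega) (by omega) 1 ?_ (fun v => z) ?_ ?_ {z}ᶜ ?_ ?_
    · refine le_trans ?_ (Ideal.height_mono (Ideal.span_mono (Set.image_mono
        ((Set.singleton_subset_iff (a := z)).mpr ?_))))
      · exact_mod_cast one_le_height k n z
      · simp [z]
    · intro v; rfl
    · intro v; have := v.2; simp [z]; omega
    · intro j hj
      simp only [Finset.mem_compl, Finset.mem_singleton] at hj
      exact Ne.symm hj
    · rw [Finset.card_compl, Finset.card_singleton, Fintype.card_fin]
end
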